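/- arXiv:1008.3768 — 2 statements merged into one kernel-verified Lean document; each statement's English description precedes it below -/
import Mathlib

section
/- Let n ≥ 3. The space BVal of continuous translation biinvariant complex-valued bivaluations on convex bodies in an n-dimensional Euclidean vector space admits the direct sum decomposition BVal = ⊕_{i,j=0}^n BVal_{i,j} into its subspaces of bivaluations of bidegree (i,j). -/
open scoped Pointwise NNReal
noncomputable section

abbrev En (n : ℕ) : Type := EuclideanSpace ℝ (Fin n)
abbrev Body (n : ℕ) : Type := ConvexBody (En n)

/-- The special orthogonal group `SO(n)`, as a subgroup of the orthogonal group. -/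
def SOGroup (n : ℕ) : Subgroup (Matrix.orthogonalGroup (Fin n) ℝ) where
  carrier := {g | Matrix.det (g : Matrix (Fin n) (Fin n) ℝ) = 1}
  one_mem' := by simp
  mul_mem' := by
    intro a b ha hb
    simp only [Set.mem_setOf_eq] at *
    rw [Submonoid.coe_mul, Matrix.det_mul, ha, hb, mul_one]
  inv_mem' := by
    intro a ha
    simp only [Set.mem_setOf_eq] at *
    have h : ((a * a⁻¹ : Matrix.orthogonalGroup (Fin n) ℝ) : Matrix (Fin n) (Fin n) ℝ) = 1 := by
      rw [mul_inv_cancel]; rfl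
    rw [Submonoid.coe_mul] at h
    have h2 := congrArg Matrix.det h
    rw [Matrix.det_mul, ha, one_mul, Matrix.det_one] at h2
    exact h2

/-- The underlying matrix of an element of `O(n)`. -/
def OMat {n : ℕ} (g : Matrix.orthogonalGroup (Fin n) ℝ) : Matrix (Fin n) (Fin n) ℝ := g

/-- The underlying matrix of an element of `SO(n)`. -/
def SOMat {n : ℕ} (g : SOGroup n) : Matrix (Fin n) (Fin n) ℝ := ((g : Matrix.orthogonalGroup (Fin n) ℝ) : Matrix (Fin n) (Fin n) ℝ)

def mapBody {n : ℕ} (A : Matrix (Fin n) (Fin n) ℝ) (K : Body n) : Body n where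
  carrier := (Matrix.toEuclideanLin A) '' (K : Set (En n))
  convex' := K.convex.linear_image _
  isCompact' := K.isCompact.image (LinearMap.continuous_of_finiteDimensional _)
  nonempty' := K.nonempty.image _

/-- Rotation of a convex body by an element of `SO(n)`. -/
def rotBody {n : ℕ} (g : SOGroup n) (K : Body n) : Body n := mapBody (SOMat g) K

/-- Rotation of a convex body by an element of `O(n)`. -/
def rotBodyO {n : ℕ} (g : Matrix.orthogonalGroup (Fin n) ℝ) (K : Body n) : Body n := mapBody (OMat g) K

/-- The natural action of `SO(n)` on complex-valued functions of convex bodies. -/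
def actVal {n : ℕ} {M : Type*} (g : SOGroup n) (φ : Body n → M) : Body n → M :=
  fun K => φ (rotBody g⁻¹ K)

/-- Volume of a convex body. -/
def bvol {n : ℕ} (K : Body n) : ℝ := (MeasureTheory.volume (K : Set (En n))).toReal

/-- The mixed volume of an `n`-tuple of convex bodies, defined through the standard
polarization formula. -/
def mixedVol {n : ℕ} (K : Fin n → Body n) : ℝ :=
  (n.factorial : ℝ)⁻¹ * ∑ S : Finset (Fin n),
    if S.Nonempty then (-1 : ℝ) ^ (n - S.card) * bvol (∑ i ∈ S, K i) else 0

/-- The Euclidean unit ball as a convex body. -/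
def unitB (n : ℕ) : Body n where
  carrier := Metric.closedBall (0 : En n) 1
  convex' := convex_closedBall _ _
  isCompact' := isCompact_closedBall _ _
  nonempty' := ⟨0, Metric.mem_closedBall_self zero_le_one⟩

/-- The `j`-th quermassintegral `W_j(K)`: the mixed volume of `n - j` copies of `K` and
`j` copies of the unit ball. -/
def quer {n : ℕ} (j : ℕ) (K : Body n) : ℝ :=
  mixedVol (fun l => if (l : ℕ) < n - j then K else unitB n)

/-- The mixed quermassintegral `W_j(K, L)`: the mixed volume of `n - 1 - j` copies of `K`,
`j` copies of the unit ball and one copy of `L`. -/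
def querM {n : ℕ} (j : ℕ) (K L : Body n) : ℝ :=
  mixedVol (fun l => if (l : ℕ) < n - 1 - j then K else if (l : ℕ) < n - 1 then unitB n else L)

/-- The volume `κ_m` of the `m`-dimensional Euclidean unit ball. -/
def kappa (m : ℕ) : ℝ := (MeasureTheory.volume (Metric.closedBall (0 : En m) 1)).toReal

/-- The `i`-th intrinsic volume, normalized by `κ_{n-i} V_i(K) = (n choose i) W_{n-i}(K)`. -/
def intrVol {n : ℕ} (i : ℕ) (K : Body n) : ℝ :=
  (n.choose i : ℝ) * quer (n - i) K / kappa (n - i)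

/-- Two convex bodies are homothetic if one is a translate of a positive dilate of the other. -/
def Homothetic {n : ℕ} (K L : Body n) : Prop :=
  ∃ (t : ℝ) (x : En n), 0 < t ∧ (L : Set (En n)) = (fun y => x + t • y) '' (K : Set (En n))

/-- A convex body with nonempty interior. -/
def HasInterior {n : ℕ} (K : Body n) : Prop := (interior (K : Set (En n))).Nonempty


/-- The translate of a convex body by a vector. -/
def transBody {n : ℕ} (x : En n) (K : Body n) : Body n where
  carrier := (fun y => x + y) '' (K : Set (En n))
  convex' := K.convex.translate x
  isCompact' := K.isCompact.image (continuous_const.add continuous_id)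
  nonempty' := K.nonempty.image _

/-- The dilate of a convex body by a real factor. -/
def scaleBody {n : ℕ} (t : ℝ) (K : Body n) : Body n where
  carrier := t • (K : Set (En n))
  convex' := K.convex.smul t
  isCompact' := K.isCompact.smul t
  nonempty' := K.nonempty.smul_set

/-- `φ` is a valuation: additive on unions of convex bodies which are again convex bodies. -/
def IsValuation {n : ℕ} {M : Type*} [Add M] (φ : Body n → M) : Prop :=
  ∀ K L U I : Body n,
    (U : Set (En n)) = (K : Set (En n)) ∪ (L : Set (En n)) →
    (I : Set (En n)) = (K : Set (En n)) ∩ (L : Set (En n)) →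
    φ K + φ L = φ U + φ I

/-- `φ` is translation invariant. -/
def IsTransInv {n : ℕ} {M : Type*} (φ : Body n → M) : Prop :=
  ∀ (x : En n) (K : Body n), φ (transBody x K) = φ K

/-- `φ` (scalar- or vector-valued) is homogeneous of degree `i`. -/
def IsHomog {n : ℕ} {M : Type*} [SMul ℝ M] (i : ℕ) (φ : Body n → M) : Prop :=
  ∀ (t : ℝ), 0 < t → ∀ K : Body n, φ (scaleBody t K) = (t ^ i : ℝ) • φ K

/-- `φ` is a continuous, translation invariant valuation. -/
def IsContTIVal {n : ℕ} {M : Type*} [Add M] [TopologicalSpace M] (φ : Body n → M) : Prop :=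
  Continuous φ ∧ IsValuation φ ∧ IsTransInv φ

/-- `φ` is a bivaluation: a valuation in each of its two arguments. -/
def IsBival {n : ℕ} {M : Type*} [Add M] (φ : Body n → Body n → M) : Prop :=
  (∀ L : Body n, IsValuation (fun K => φ K L)) ∧ (∀ K : Body n, IsValuation (φ K))

/-- `φ` is invariant under independent translations of its two arguments. -/
def IsTransBiinv {n : ℕ} {M : Type*} (φ : Body n → Body n → M) : Prop :=
  ∀ (x y : En n) (K L : Body n), φ (transBody x K) (transBody y L) = φ K L

/-- `φ` has bidegree `(i, j)`. -/
def IsBihomog {n : ℕ} {M : Type*} [SMul ℝ M] (i j : ℕ) (φ : Body n → Body n → M) : Prop :=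
  ∀ (t s : ℝ), 0 < t → 0 < s → ∀ K L : Body n,
    φ (scaleBody t K) (scaleBody s L) = (t ^ i * s ^ j : ℝ) • φ K L

/-- `φ` is `O(n)` invariant. -/
def IsOBiinv {n : ℕ} {M : Type*} (φ : Body n → Body n → M) : Prop :=
  ∀ (g : Matrix.orthogonalGroup (Fin n) ℝ) (K L : Body n), φ (rotBodyO g K) (rotBodyO g L) = φ K L

/-- `φ` is `SO(n)` invariant. -/
def IsSOBiinv {n : ℕ} {M : Type*} (φ : Body n → Body n → M) : Prop :=
  ∀ (g : SOGroup n) (K L : Body n), φ (rotBody g K) (rotBody g L) = φ K L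

/-- `φ` is jointly continuous. -/
def ContinuousBi {n : ℕ} {M : Type*} [TopologicalSpace M] (φ : Body n → Body n → M) : Prop :=
  Continuous fun p : Body n × Body n => φ p.1 p.2

/-- A continuous translation invariant Minkowski valuation which is
homogeneous of degree `i`. -/
def IsMinkValHom {n : ℕ} (i : ℕ) (Φ : Body n → Body n) : Prop :=
  Continuous Φ ∧ IsValuation Φ ∧ IsTransInv Φ ∧
    ∀ (t : ℝ), 0 < t → ∀ K : Body n, Φ (scaleBody t K) = scaleBody (t ^ i) (Φ K)

/-- A Minkowski valuation is `SO(n)` equivariant. -/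
def IsSOEquivariant {n : ℕ} (Φ : Body n → Body n) : Prop :=
  ∀ (g : SOGroup n) (K : Body n), Φ (rotBody g K) = rotBody g (Φ K)

/-- A Minkowski valuation is `O(n)` equivariant. -/
def IsOEquivariant {n : ℕ} (Φ : Body n → Body n) : Prop :=
  ∀ (g : Matrix.orthogonalGroup (Fin n) ℝ) (K : Body n), Φ (rotBodyO g K) = rotBodyO g (Φ K)

/-- The space `BVal` of continuous translation biinvariant complex-valued bivaluations,
as a subspace of the space of all functions `K^n × K^n → ℂ`. -/
def BValSub (n : ℕ) : Submodule ℂ (Body n → Body n → ℂ) where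
  carrier := {φ | ContinuousBi φ ∧ IsBival φ ∧ IsTransBiinv φ}
  zero_mem' := by
    refine ⟨continuous_const, ⟨?_, ?_⟩, ?_⟩
    · intro _ _ _ _ _ _ _; simp
    · intro _ _ _ _ _ _ _; simp
    · intro _ _ _ _; simp
  add_mem' := by
    rintro φ ψ ⟨hc1, ⟨hv1a, hv1b⟩, ht1⟩ ⟨hc2, ⟨hv2a, hv2b⟩, ht2⟩
    refine ⟨hc1.add hc2, ⟨fun L => ?_, fun K => ?_⟩, fun x y K L => ?_⟩
    · intro K1 K2 U I hU hI
      simp only [Pi.add_apply]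
      linear_combination hv1a L K1 K2 U I hU hI + hv2a L K1 K2 U I hU hI
    · intro L1 L2 U I hU hI
      simp only [Pi.add_apply]
      linear_combination hv1b K L1 L2 U I hU hI + hv2b K L1 L2 U I hU hI
    · simp only [Pi.add_apply, ht1 x y K L, ht2 x y K L]
  smul_mem' := by
    rintro c φ ⟨hc1, ⟨hv1a, hv1b⟩, ht1⟩
    refine ⟨hc1.const_smul c, ⟨fun L => ?_, fun K => ?_⟩, fun x y K L => ?_⟩
    · intro K1 K2 U I hU hI
      simp only [Pi.smul_apply, smul_eq_mul]
      linear_combination c * hv1a L K1 K2 U I hU hI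
    · intro L1 L2 U I hU hI
      simp only [Pi.smul_apply, smul_eq_mul]
      linear_combination c * hv1b K L1 L2 U I hU hI
    · simp only [Pi.smul_apply, ht1 x y K L]


/-- The subspace `BVal_{i,j} ⊆ BVal` of bivaluations of bidegree `(i,j)`. -/
def BValIJ (n i j : ℕ) : Submodule ℂ (BValSub n) where
  carrier := {φ | IsBihomog i j (φ : Body n → Body n → ℂ)}
  zero_mem' := by intro t s ht hs K L; simp
  add_mem' := by
    intro φ ψ hφ hψ t s ht hs K L
    simp only [Submodule.coe_add, Pi.add_apply, hφ t s ht hs K L, hψ t s ht hs K L,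
      smul_add]
  smul_mem' := by
    intro c φ hφ t s ht hs K L
    simp only [Submodule.coe_smul, Pi.smul_apply, hφ t s ht hs K L]
    rw [smul_comm]

namespace ConvexBody

open Polynomial Filter Topology

variable {n : ℕ}

/-- The one-point convex body `{x}`. -/
def point (x : En n) : Body n :=
  ⟨{x}, convex_singleton x, isCompact_singleton, Set.singleton_nonempty x⟩

theorem transBody_eq_point_add (x : En n) (K : Body n) : transBody x K = point x + K :=
  ConvexBody.ext Set.singleton_add.symm

theorem natCast_smul_eq_nsmul (k : ℕ) (K : Body n) : (k : ℝ) • K = k • K := by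
  rw [← Nat.cast_smul_eq_nsmul ℝ≥0 k K]
  rfl

theorem mem_nsmul {k : ℕ} {K : Body n} {x : En n} :
    x ∈ k • K ↔ ∃ y ∈ K, x = (k : ℝ) • y := by
  rw [← natCast_smul_eq_nsmul, ← SetLike.mem_coe, coe_smul, Set.mem_smul_set]
  simp [eq_comm]

theorem mem_add {K L : Body n} {x : En n} : x ∈ K + L ↔ ∃ y ∈ K, ∃ z ∈ L, y + z = x := by
  rw [← SetLike.mem_coe, coe_add, Set.mem_add]
  simp

theorem nsmul_point (k : ℕ) (x : En n) : k • point x = point ((k : ℝ) • x) := by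
  rw [← natCast_smul_eq_nsmul]
  exact ConvexBody.ext Set.smul_set_singleton

/-- If the union of two closed sets contains a segment joining them, the segment meets the
intersection. -/
theorem exists_mem_segment_inter {s t : Set (En n)} (hs : IsClosed s) (ht : IsClosed t)
    (hc : Convex ℝ (s ∪ t)) {x y : En n} (hx : x ∈ s) (hy : y ∈ t) :
    ∃ z ∈ segment ℝ x y, z ∈ s ∩ t := by
  have h := isPreconnected_closed_iff.1 (convex_segment (𝕜 := ℝ) x y).isPreconnected s t hs ht
    (hc.segment_subset (Or.inl hx) (Or.inr hy)) ⟨x, left_mem_segment ℝ x y, hx⟩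
    ⟨y, right_mem_segment ℝ x y, hy⟩
  obtain ⟨z, hz, hz'⟩ := h
  exact ⟨z, hz, hz'⟩

theorem _root_.IsValuation.comp_add {φ : Body n → ℂ} (hφ : IsValuation φ) (B : Body n) :
    IsValuation fun K => φ (K + B) := by
  intro K L U I hU hI
  refine hφ _ _ _ _ ?_ (Set.Subset.antisymm ?_ ?_)
  · simp only [coe_add, hU, Set.union_add]
  · simp only [coe_add, hI]
    exact Set.inter_add_subset
  · rintro x ⟨⟨k, hk, b, hb, rfl⟩, ⟨l, hl, c, hc, hlc⟩⟩
    obtain ⟨z, ⟨u, v, hu, hv, huv, rfl⟩, hz⟩ :=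
      exists_mem_segment_inter K.isClosed L.isClosed (hU ▸ U.convex) hk hl
    rw [coe_add, hI]
    refine ⟨_, hz, u • b + v • c, B.convex hb hc hu hv huv, ?_⟩
    simp only at hlc ⊢
    calc u • k + v • l + (u • b + v • c) = u • (k + b) + v • (l + c) := by module
      _ = k + b := by rw [hlc, ← add_smul, huv, one_smul]

theorem _root_.IsTransInv.comp_add {φ : Body n → ℂ} (hφ : IsTransInv φ) (B : Body n) :
    IsTransInv fun K => φ (K + B) := by
  intro x K
  simp only [transBody_eq_point_add, add_assoc]
  rw [← transBody_eq_point_add, hφ]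

theorem _root_.IsTransInv.point_add {φ : Body n → ℂ} (hφ : IsTransInv φ) (x : En n)
    (K : Body n) : φ (point x + K) = φ K := by
  rw [← transBody_eq_point_add, hφ]

/-- The dilates of a cone `C` with apex `0` over `Q` satisfy
`(k + 1) C = k C ∪ (k Q + C)` and `k C ∩ (k Q + C) = k Q`. -/
theorem _root_.IsValuation.nsmul_cone {φ : Body n → ℂ} (hφ : IsValuation φ) {Q C : Body n}
    (hC : ∀ x, x ∈ C ↔ ∃ r : ℝ, 0 ≤ r ∧ r ≤ 1 ∧ ∃ q ∈ Q, x = r • q) (k : ℕ) :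
    φ (k • C) + φ (k • Q + C) = φ ((k + 1) • C) + φ (k • Q) := by
  have hQC : ∀ q ∈ Q, q ∈ C := fun q hq => (hC q).2 ⟨1, zero_le_one, le_rfl, q, hq, by simp⟩
  have h0C : (0 : En n) ∈ C := by
    obtain ⟨q, hq⟩ := Q.nonempty
    exact (hC 0).2 ⟨0, le_rfl, zero_le_one, q, hq, by simp⟩
  have hk0 : (0 : ℝ) ≤ k := k.cast_nonneg
  refine hφ _ _ _ _ (Set.Subset.antisymm ?_ ?_) (Set.Subset.antisymm ?_ ?_)
  · intro x hx
    rw [SetLike.mem_coe, mem_nsmul] at hx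
    obtain ⟨y, hy, rfl⟩ := hx
    obtain ⟨r, hr0, hr1, q, hq, rfl⟩ := (hC y).1 hy
    rw [Nat.cast_succ]
    rcases le_total ((k + 1) * r) k with h | h
    · left
      rw [SetLike.mem_coe, mem_nsmul]
      rcases hk0.eq_or_lt with h0 | h0
      · refine ⟨0, h0C, ?_⟩
        have : r = 0 := by rw [← h0] at h; linarith
        simp [this]
      · refine ⟨((k + 1) * r / k) • q, (hC _).2 ⟨_, by positivity, ?_, q, hq, rfl⟩, ?_⟩
        · rwa [div_le_one h0]
        · rw [smul_smul, smul_smul]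
          congr 1
          field_simp
    · right
      rw [SetLike.mem_coe, mem_add]
      refine ⟨(k : ℝ) • q, mem_nsmul.2 ⟨q, hq, rfl⟩, ((k + 1) * r - k) • q,
        (hC _).2 ⟨_, by linarith, by nlinarith, q, hq, rfl⟩, by module⟩
  · rintro x (hx | hx) <;> rw [SetLike.mem_coe] at * <;> rw [succ_nsmul, mem_add]
    · exact ⟨x, hx, 0, h0C, add_zero x⟩
    · obtain ⟨y, hy, z, hz, rfl⟩ := mem_add.1 hx
      obtain ⟨q, hq, rfl⟩ := mem_nsmul.1 hy
      exact ⟨_, mem_nsmul.2 ⟨q, hQC q hq, rfl⟩, z, hz, rfl⟩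
  · intro x hx
    obtain ⟨q, hq, rfl⟩ := mem_nsmul.1 hx
    exact ⟨mem_nsmul.2 ⟨q, hQC q hq, rfl⟩, mem_add.2 ⟨_, hx, 0, h0C, add_zero _⟩⟩
  · rintro x ⟨hx, hx'⟩
    obtain ⟨y, hy, rfl⟩ := mem_nsmul.1 hx
    obtain ⟨r, hr0, hr1, q, hq, rfl⟩ := (hC y).1 hy
    obtain ⟨y', hy', z, hz, hyz⟩ := mem_add.1 hx'
    obtain ⟨q₁, hq₁, rfl⟩ := mem_nsmul.1 hy'
    obtain ⟨m, hm0, hm1, q₂, hq₂, rfl⟩ := (hC z).1 hz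
    refine mem_nsmul.2 ?_
    rcases hr1.eq_or_lt with rfl | hr1
    · exact ⟨q, hq, by simp⟩
    rcases hk0.eq_or_lt with h0 | h0
    · exact ⟨q, hq, by simp [← h0]⟩
    have hd : 0 < m + k * (1 - r) := by nlinarith
    set s : ℝ := m / (m + k * (1 - r)) with hs
    have hs0 : 0 ≤ s := by positivity
    have hs1 : 1 - s = k * (1 - r) / (m + k * (1 - r)) := by rw [hs]; field_simp; ring
    have hs2 : 0 ≤ 1 - s := by
      rw [hs1]
      exact div_nonneg (mul_nonneg hk0 (by linarith)) hd.le
    have hsum : s * r + ((1 - s) + (1 - s) * (m / k)) = 1 := by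
      rw [hs1, hs]; field_simp; ring
    refine ⟨(s * r) • q + ((1 - s) • q₁ + ((1 - s) * (m / k)) • q₂), ?_, ?_⟩
    · have hmem := Q.convex.sum_mem (t := Finset.univ)
        (w := ![s * r, 1 - s, (1 - s) * (m / k)]) (z := ![q, q₁, q₂])
        (by
          have hmk : 0 ≤ (1 - s) * (m / k) := mul_nonneg hs2 (by positivity)
          have hsr : 0 ≤ s * r := mul_nonneg hs0 hr0
          intro i _; fin_cases i <;> assumption)
        (by simp [Fin.sum_univ_three]; linarith)
        (by intro i _; fin_cases i <;> simpa)
      simpa [Fin.sum_univ_three, add_assoc] using hmem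
    · calc (k : ℝ) • r • q = s • (k : ℝ) • r • q + (1 - s) • (k : ℝ) • r • q := by module
        _ = s • (k : ℝ) • r • q + (1 - s) • ((k : ℝ) • q₁ + m • q₂) := by rw [hyz]
        _ = _ := by
          simp only [smul_add, smul_smul]
          rw [show (k : ℝ) * ((1 - s) * (m / k)) = (1 - s) * m by field_simp,
            show (k : ℝ) * (s * r) = s * (k * r) by ring, mul_comm (1 - s) (k : ℝ)]

/-- Indefinite summation of a polynomial sequence gives a polynomial sequence. -/
theorem exists_poly_of_sub_eq {f : ℕ → ℂ} (p : ℂ[X])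
    (h : ∀ k : ℕ, f (k + 1) - f k = p.eval (k : ℂ)) :
    ∃ q : ℂ[X], ∀ k : ℕ, f k = q.eval (k : ℂ) := by
  have key : ∀ p : ℂ[X], ∃ q : ℂ[X], ∀ k : ℕ,
      ∑ j ∈ Finset.range k, p.eval (j : ℂ) = q.eval (k : ℂ) := by
    intro p
    induction p using Polynomial.induction_on' with
    | add p₁ p₂ h₁ h₂ =>
      obtain ⟨q₁, h₁⟩ := h₁
      obtain ⟨q₂, h₂⟩ := h₂
      exact ⟨q₁ + q₂, fun k => by simp [Finset.sum_add_distrib, h₁, h₂]⟩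
    | monomial m a =>
      refine ⟨C a * ∑ i ∈ Finset.range (m + 1),
        C ((_root_.bernoulli i * ((m + 1).choose i) / (m + 1) : ℚ) : ℂ) * X ^ (m + 1 - i),
        fun k => ?_⟩
      have := congrArg (fun x : ℚ => (x : ℂ)) (sum_range_pow k m)
      push_cast at this
      simp only [eval_monomial, ← Finset.mul_sum, this, eval_mul, eval_C, eval_finsetSum, eval_pow,
        eval_X]
      congr 1
      refine Finset.sum_congr rfl fun i _ => ?_
      push_cast
      ring
  obtain ⟨q, hq⟩ := key p
  refine ⟨C (f 0) + q, fun k => ?_⟩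
  rw [eval_add, eval_C, ← hq, ← Finset.sum_congr rfl fun j _ => h j, Finset.sum_range_sub]
  ring

/-- Translation invariant valuations are polynomial on the integer multiples of a polytope. -/
theorem exists_poly_nsmul {s : Finset (En n)} (hs : s.Nonempty) :
    ∀ P : Body n, (P : Set (En n)) = convexHull ℝ (s : Set (En n)) → ∀ φ : Body n → ℂ,
      IsValuation φ → IsTransInv φ → ∃ p : ℂ[X], ∀ k : ℕ, φ (k • P) = p.eval (k : ℂ) := by
  induction hs using Finset.Nonempty.cons_induction with
  | singleton a =>
    intro P hP φ _ hφ
    have : P = point a := ConvexBody.ext (by simp [hP, point])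
    refine ⟨C (φ 0), fun k => ?_⟩
    rw [this, nsmul_point, ← add_zero (point _), hφ.point_add, eval_C]
  | cons a s has hs ih =>
    intro P hP φ hv ht
    let R : Body n := ⟨convexHull ℝ (s : Set (En n)), convex_convexHull ℝ _,
      s.finite_toSet.isCompact_convexHull ℝ, (Finset.coe_nonempty.2 hs).convexHull⟩
    have hR : ∀ ψ : Body n → ℂ, IsValuation ψ → IsTransInv ψ →
        ∃ p : ℂ[X], ∀ k : ℕ, ψ (k • (point (-a) + R)) = p.eval (k : ℂ) := by
      intro ψ hψ hψ'
      obtain ⟨p, hp⟩ := ih R rfl ψ hψ hψ'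
      exact ⟨p, fun k => by rw [nsmul_add, nsmul_point, hψ'.point_add, hp]⟩
    have hcone : ∀ x, x ∈ point (-a) + P ↔
        ∃ r : ℝ, 0 ≤ r ∧ r ≤ 1 ∧ ∃ q ∈ point (-a) + R, x = r • q := by
      have hmem : ∀ (K : Body n) x, x ∈ point (-a) + K ↔ a + x ∈ K := by
        intro K x
        rw [mem_add]
        constructor
        · rintro ⟨y, rfl, z, hz, rfl⟩
          simpa using hz
        · exact fun h => ⟨-a, rfl, _, h, by abel⟩
      intro x
      rw [hmem, ← SetLike.mem_coe, hP, Finset.coe_cons,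
        convexHull_insert (Finset.coe_nonempty.2 hs), convexJoin_singleton_left, Set.mem_iUnion₂]
      constructor
      · rintro ⟨y, hy, u, v, hu, hv, huv, hx⟩
        refine ⟨v, hv, by linarith, y - a, (hmem _ _).2 (by rwa [add_sub_cancel]), ?_⟩
        obtain rfl : u = 1 - v := by linarith
        rw [← add_right_inj a, ← hx]
        module
      · rintro ⟨r, hr0, hr1, q, hq, rfl⟩
        exact ⟨a + q, (hmem _ _).1 hq, 1 - r, r, by linarith, hr0, by ring, by module⟩
    obtain ⟨p₁, hp₁⟩ := hR _ (hv.comp_add (point (-a) + P)) (ht.comp_add (point (-a) + P))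
    obtain ⟨p₂, hp₂⟩ := hR φ hv ht
    obtain ⟨q, hq⟩ := exists_poly_of_sub_eq (f := fun k => φ (k • (point (-a) + P))) (p₁ - p₂)
      (fun k => by
        rw [eval_sub, ← hp₁, ← hp₂]
        linear_combination -hv.nsmul_cone hcone k)
    refine ⟨q, fun k => ?_⟩
    rw [← hq, nsmul_add, nsmul_point, ht.point_add]

/-- `K` lies between two hyperplanes `x i = c` and `x i = c + w`. -/
def WidthLE (i : Fin n) (w : ℝ) (K : Body n) : Prop :=
  ∀ x ∈ K, ∀ y ∈ K, x i - y i ≤ w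

theorem WidthLE.mono {i : Fin n} {v w : ℝ} {K L : Body n} (h : WidthLE i v K)
    (hL : (L : Set (En n)) ⊆ K) (hvw : v ≤ w) : WidthLE i w L :=
  fun x hx y hy => (h x (hL hx) y (hL hy)).trans hvw

theorem continuous_coord (i : Fin n) : Continuous fun x : En n => x i := by fun_prop

/-- Dissecting a body by a hyperplane that meets it. -/
theorem _root_.IsValuation.exists_cut {φ : Body n → ℂ} (hφ : IsValuation φ) (K : Body n)
    (i : Fin n) (c : ℝ) {x y : En n} (hx : x ∈ K) (hy : y ∈ K) (hxc : x i ≤ c) (hyc : c ≤ y i) :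
    ∃ A B I : Body n, (A : Set (En n)) = (K : Set (En n)) ∩ {x | x i ≤ c} ∧
      (B : Set (En n)) = (K : Set (En n)) ∩ {x | c ≤ x i} ∧
      (I : Set (En n)) = (A : Set (En n)) ∩ (B : Set (En n)) ∧ φ K = φ A + φ B - φ I := by
  have hA : IsClosed {x : En n | x i ≤ c} := isClosed_le (continuous_coord i) continuous_const
  have hB : IsClosed {x : En n | c ≤ x i} := isClosed_le continuous_const (continuous_coord i)
  have hA' : Convex ℝ {x : En n | x i ≤ c} :=
    convex_halfSpace_le ⟨fun _ _ => rfl, fun _ _ => rfl⟩ c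
  have hB' : Convex ℝ {x : En n | c ≤ x i} :=
    convex_halfSpace_ge ⟨fun _ _ => rfl, fun _ _ => rfl⟩ c
  let A : Body n := ⟨K ∩ {x | x i ≤ c}, K.convex.inter hA', K.isCompact.inter_right hA, x, hx, hxc⟩
  let B : Body n := ⟨K ∩ {x | c ≤ x i}, K.convex.inter hB', K.isCompact.inter_right hB, y, hy, hyc⟩
  have hU : (K : Set (En n)) = (A : Set (En n)) ∪ (B : Set (En n)) := by
    ext z
    change z ∈ (K : Set (En n)) ↔
      (z ∈ (K : Set (En n)) ∧ z i ≤ c) ∨ (z ∈ (K : Set (En n)) ∧ c ≤ z i)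
    have := le_total (z i) c
    tauto
  obtain ⟨z, -, hz⟩ := exists_mem_segment_inter A.isClosed B.isClosed (hU ▸ K.convex)
    (show x ∈ (A : Set (En n)) from ⟨hx, hxc⟩) (show y ∈ (B : Set (En n)) from ⟨hy, hyc⟩)
  let I : Body n := ⟨(A : Set (En n)) ∩ (B : Set (En n)), A.convex.inter B.convex,
    A.isCompact.inter B.isCompact, z, hz⟩
  exact ⟨A, B, I, rfl, rfl, rfl, by linear_combination -hφ A B K I hU rfl⟩

/-- If a valuation is bounded by `M` on the members of a hereditary class that have width at most
`w` in a coordinate direction, it is bounded by `(2 N + 1) M` on those of width at most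
`(N + 1) w`. -/
theorem _root_.IsValuation.norm_le_of_widthLE {φ : Body n → ℂ} (hφ : IsValuation φ) {i : Fin n}
    {w M : ℝ} (hw : 0 ≤ w) (hM : 0 ≤ M) {𝒞 : Set (Body n)}
    (h𝒞 : ∀ K ∈ 𝒞, ∀ L : Body n, (L : Set (En n)) ⊆ K → L ∈ 𝒞)
    (hφM : ∀ K ∈ 𝒞, WidthLE i w K → ‖φ K‖ ≤ M) (N : ℕ) :
    ∀ K ∈ 𝒞, WidthLE i ((N + 1) * w) K → ‖φ K‖ ≤ (2 * N + 1) * M := by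
  induction N with
  | zero =>
    intro K hK hKw
    simpa using hφM K hK (by simpa using hKw)
  | succ N ih =>
    intro K hK hKw
    obtain ⟨x, hx, hmin⟩ := K.isCompact.exists_isMinOn K.nonempty (continuous_coord i).continuousOn
    have hmin' : ∀ y ∈ K, x i ≤ y i := fun y hy => hmin hy
    by_cases hy : ∃ y ∈ K, x i + w ≤ y i
    · obtain ⟨y, hy, hyw⟩ := hy
      obtain ⟨A, B, I, hA, hB, hI, h⟩ :=
        hφ.exists_cut K i (x i + w) hx hy (by linarith) hyw
      have hAK : (A : Set (En n)) ⊆ K := hA ▸ Set.inter_subset_left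
      have hBK : (B : Set (En n)) ⊆ K := hB ▸ Set.inter_subset_left
      have hIA : (I : Set (En n)) ⊆ A := hI ▸ Set.inter_subset_left
      have hAw : WidthLE i w A := by
        intro a ha b hb
        have h₁ : a i ≤ x i + w := (hA ▸ ha : a ∈ (K : Set (En n)) ∩ {z | z i ≤ x i + w}).2
        have := hmin' b (hAK hb)
        linarith
      have hBw : WidthLE i ((N + 1) * w) B := by
        intro a ha b hb
        have h₁ : x i + w ≤ b i := (hB ▸ hb : b ∈ (K : Set (En n)) ∩ {z | x i + w ≤ z i}).2
        have h₂ := hKw a (hBK ha) x hx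
        push_cast at h₂
        linarith
      have h₁ := hφM A (h𝒞 K hK A hAK) hAw
      have h₂ := ih B (h𝒞 K hK B hBK) hBw
      have h₃ := hφM I (h𝒞 K hK I (hIA.trans hAK)) (hAw.mono hIA le_rfl)
      rw [h]
      push_cast
      linarith [norm_sub_le (φ A + φ B) (φ I), norm_add_le (φ A) (φ B)]
    · push Not at hy
      have := hφM K hK fun a ha b hb => by linarith [hy a ha, hmin' b hb]
      push_cast
      nlinarith [mul_nonneg (Nat.cast_nonneg (α := ℝ) N) hM]

/-- A valuation bounded by `M` on all bodies contained in a translate of a cube of side `w` is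
bounded by `(2 N + 1) ^ n * M` on all bodies contained in a box of side `(N + 1) * w`. -/
theorem _root_.IsValuation.norm_le_of_forall_widthLE {φ : Body n → ℂ} (hφ : IsValuation φ)
    {w M : ℝ} (hw : 0 ≤ w) (hM : 0 ≤ M) (hφM : ∀ K, (∀ i, WidthLE i w K) → ‖φ K‖ ≤ M) (N : ℕ)
    {K : Body n} (hK : ∀ i, WidthLE i ((N + 1) * w) K) : ‖φ K‖ ≤ (2 * N + 1) ^ n * M := by
  have key : ∀ s : Finset (Fin n), ∀ K : Body n, (∀ i ∈ s, WidthLE i ((N + 1) * w) K) →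
      (∀ i ∉ s, WidthLE i w K) → ‖φ K‖ ≤ (2 * N + 1) ^ s.card * M := by
    intro s
    induction s using Finset.induction_on with
    | empty =>
      intro K _ h
      simpa using hφM K fun i => h i (Finset.notMem_empty i)
    | insert i s his ih =>
      intro K h₁ h₂
      rw [Finset.card_insert_of_notMem his, pow_succ', mul_assoc]
      refine hφ.norm_le_of_widthLE (i := i) hw (by positivity)
        (𝒞 := {K | (∀ j ∈ s, WidthLE j ((N + 1) * w) K) ∧ ∀ j ∉ insert i s, WidthLE j w K})
        ?_ ?_ N K ⟨fun j hj => h₁ j (Finset.mem_insert_of_mem hj), h₂⟩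
        (h₁ i (Finset.mem_insert_self i s))
      · rintro K ⟨hK₁, hK₂⟩ L hL
        exact ⟨fun j hj => (hK₁ j hj).mono hL le_rfl, fun j hj => (hK₂ j hj).mono hL le_rfl⟩
      · rintro K ⟨hK₁, hK₂⟩ hK
        refine ih K hK₁ fun j hj => ?_
        rcases eq_or_ne j i with rfl | hji
        · exact hK
        · exact hK₂ j (by simp [hji, hj])
  simpa using key Finset.univ K (fun i _ => hK i) (by simp)

theorem dist_le_of_forall_mem {K L : Body n} {r : ℝ} (hr : 0 ≤ r)
    (h₁ : ∀ x ∈ K, ∃ y ∈ L, dist x y ≤ r) (h₂ : ∀ x ∈ L, ∃ y ∈ K, dist x y ≤ r) :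
    dist K L ≤ r :=
  Metric.hausdorffDist_le_of_mem_dist hr h₁ h₂

theorem exists_mem_dist_le {K : Body n} (L : Body n) {x : En n} (hx : x ∈ K) :
    ∃ y ∈ L, dist x y ≤ dist K L := by
  obtain ⟨y, hy, h⟩ := L.isCompact.exists_infDist_eq_dist L.nonempty x
  exact ⟨y, hy, h ▸ Metric.infDist_le_hausdorffDist_of_mem hx hausdorffEDist_ne_top⟩

/-- A translation invariant valuation that is continuous at `{0}` is bounded on bodies contained
in translates of a sufficiently small cube. -/
theorem exists_norm_le_of_widthLE {φ : Body n → ℂ} (hc : Continuous φ) (ht : IsTransInv φ) :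
    ∃ w > 0, ∃ M ≥ 0, ∀ K, (∀ i, WidthLE i w K) → ‖φ K‖ ≤ M := by
  obtain ⟨δ, hδ, h⟩ := Metric.continuous_iff.1 hc 0 1 one_pos
  refine ⟨δ / (n + 1), by positivity, ‖φ 0‖ + 1, by positivity, fun K hK => ?_⟩
  obtain ⟨a, ha⟩ := K.nonempty
  have hlt : (n : ℝ) * (δ / (n + 1)) < δ := by
    rw [← mul_div_assoc, div_lt_iff₀ (by positivity)]
    nlinarith
  have hdist : dist (point (-a) + K) 0 < δ := by
    have hnorm : ∀ x ∈ point (-a) + K, dist x 0 ≤ n * (δ / (n + 1)) := by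
      intro x hx
      obtain ⟨y, rfl, z, hz, rfl⟩ := mem_add.1 hx
      rw [dist_zero_right, EuclideanSpace.norm_eq]
      refine (Real.sqrt_le_sqrt (Finset.sum_sq_le_sq_sum_of_nonneg
        fun _ _ => norm_nonneg _)).trans ?_
      rw [Real.sqrt_sq (Finset.sum_nonneg fun _ _ => norm_nonneg _)]
      refine (Finset.sum_le_card_nsmul _ _ (δ / (n + 1)) fun i _ => ?_).trans (by simp)
      have h₁ := hK i a ha z hz
      have h₂ := hK i z hz a ha
      rw [Real.norm_eq_abs, abs_le]
      simp only [PiLp.add_apply, PiLp.neg_apply]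
      constructor <;> linarith
    refine (dist_le_of_forall_mem (by positivity) (fun x hx => ⟨0, rfl, hnorm x hx⟩)
      fun x hx => ?_).trans_lt hlt
    obtain rfl : x = 0 := hx
    refine ⟨0, mem_add.2 ⟨-a, rfl, a, ha, by simp⟩, ?_⟩
    rw [dist_self]
    positivity
  have := h _ hdist
  rw [ht.point_add, dist_eq_norm] at this
  linarith [norm_le_norm_add_norm_sub' (φ K) (φ 0)]

/-- A continuous translation invariant valuation on bodies of dimension at most `n` grows at most
like the `n`-th power of the size of the body. -/
theorem exists_norm_nsmul_le {φ : Body n → ℂ} (hφ : IsContTIVal φ) (K : Body n) :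
    ∃ C : ℝ, ∀ k : ℕ, 1 ≤ k → ‖φ (k • K)‖ ≤ C * (k : ℝ) ^ n := by
  obtain ⟨hc, hv, ht⟩ := hφ
  obtain ⟨w, hw, M, hM, h⟩ := exists_norm_le_of_widthLE hc ht
  obtain ⟨R, hR, hKR⟩ := K.isBounded.exists_pos_norm_le
  obtain ⟨m, hm⟩ := exists_nat_ge (2 * R / w)
  rw [div_le_iff₀ hw] at hm
  refine ⟨(2 * m + 1) ^ n * M, fun k hk => ?_⟩
  have hk' : (1 : ℝ) ≤ k := by exact_mod_cast hk
  have key := hv.norm_le_of_forall_widthLE hw.le hM h (k * m) (K := k • K) ?_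
  · calc ‖φ (k • K)‖ ≤ (2 * (k * m : ℕ) + 1) ^ n * M := key
      _ ≤ ((2 * m + 1) * k) ^ n * M := by
        gcongr
        push_cast
        nlinarith
      _ = _ := by rw [mul_pow]; ring
  · intro i x hx y hy
    obtain ⟨u, hu, rfl⟩ := mem_nsmul.1 hx
    obtain ⟨v, hv, rfl⟩ := mem_nsmul.1 hy
    have h₁ := (abs_le.1 ((PiLp.norm_apply_le u i).trans (hKR u hu))).2
    have h₂ := (abs_le.1 ((PiLp.norm_apply_le v i).trans (hKR v hv))).1
    simp only [PiLp.smul_apply, smul_eq_mul]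
    push_cast
    nlinarith

/-- A polynomial bounded by a multiple of `k ^ d` on the positive integers has degree at
most `d`. -/
theorem natDegree_le_of_norm_eval_le {p : ℂ[X]} {d : ℕ} {C : ℝ}
    (h : ∀ k : ℕ, 1 ≤ k → ‖p.eval (k : ℂ)‖ ≤ C * (k : ℝ) ^ d) : p.natDegree ≤ d := by
  by_contra! hd
  have h₁ := (isLittleO_cobounded_of_degree_lt (P := (X ^ d : ℂ[X])) (Q := p)
    (by rw [degree_X_pow]; exact coe_lt_degree.2 hd)).comp_tendsto
      tendsto_natCast_atTop_cobounded
  refine h₁.not_isBigO (((eventually_ge_atTop 1).mono fun k hk => ?_).frequently)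
    (Asymptotics.IsBigO.of_bound C <| (eventually_ge_atTop 1).mono fun k hk => by
      simpa using h k hk)
  simpa using fun h => absurd h (Nat.one_le_iff_ne_zero.1 hk)

theorem continuous_const_smul_body (t : ℝ) : Continuous fun K : Body n => t • K := by
  refine (LipschitzWith.of_dist_le_mul (K := ‖t‖₊) fun K L => ?_).continuous
  have aux : ∀ K L : Body n, ∀ x ∈ t • K, ∃ y ∈ t • L, dist x y ≤ ‖t‖₊ * dist K L := by
    rintro K L _ ⟨x, hx, rfl⟩
    obtain ⟨y, hy, h⟩ := exists_mem_dist_le L hx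
    refine ⟨t • y, ⟨y, hy, rfl⟩, ?_⟩
    simp only [dist_smul₀, coe_nnnorm]
    gcongr
  exact dist_le_of_forall_mem (by positivity) (aux K L) (dist_comm K L ▸ aux L K)

theorem continuous_smul_const_body (K : Body n) : Continuous fun t : ℝ => t • K := by
  obtain ⟨R, hR, hKR⟩ := K.isBounded.exists_pos_norm_le
  refine (LipschitzWith.of_dist_le_mul (K := ⟨R, hR.le⟩) fun s t => ?_).continuous
  have aux : ∀ s t : ℝ, ∀ x ∈ s • K, ∃ y ∈ t • K, dist x y ≤ R * dist s t := by
    rintro s t _ ⟨x, hx, rfl⟩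
    refine ⟨t • x, ⟨x, hx, rfl⟩, ?_⟩
    simp only [dist_eq_norm, ← sub_smul, norm_smul, mul_comm R]
    gcongr
    exact hKR x hx
  exact dist_le_of_forall_mem (by positivity) (aux s t) (dist_comm s t ▸ aux t s)

/-- Polytopes are dense among convex bodies. -/
theorem dense_polytopes : Dense {P : Body n | ∃ s : Finset (En n), s.Nonempty ∧
    (P : Set (En n)) = convexHull ℝ (s : Set (En n))} := by
  intro K
  rw [Metric.mem_closure_iff]
  intro ε hε
  obtain ⟨t, htK, htf, hcov⟩ := K.isCompact.finite_cover_balls (half_pos hε)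
  obtain ⟨x₀, hx₀⟩ := K.nonempty
  have ht : t.Nonempty := by
    obtain ⟨y, hy, -⟩ := Set.mem_iUnion₂.1 (hcov hx₀)
    exact ⟨y, hy⟩
  have hsub : convexHull ℝ t ⊆ K := convexHull_min htK K.convex
  refine ⟨⟨convexHull ℝ t, convex_convexHull ℝ t, htf.isCompact_convexHull ℝ, ht.convexHull⟩,
    ⟨htf.toFinset, by simpa using ht, by simp⟩,
    (dist_le_of_forall_mem (half_pos hε).le (fun x hx => ?_) fun x hx => ?_).trans_lt
      (half_lt_self hε)⟩
  · obtain ⟨y, hy, hxy⟩ := Set.mem_iUnion₂.1 (hcov hx)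
    exact ⟨y, subset_convexHull ℝ t hy, (Metric.mem_ball.1 hxy).le⟩
  · exact ⟨x, hsub hx, by rw [dist_self]; positivity⟩

/-- A continuous translation invariant valuation is polynomial of degree at most `n` on the
dilates of a polytope. -/
theorem exists_poly_smul {φ : Body n → ℂ} (hφ : IsContTIVal φ) {s : Finset (En n)}
    (hs : s.Nonempty) {P : Body n} (hP : (P : Set (En n)) = convexHull ℝ (s : Set (En n))) :
    ∃ p : ℂ[X], p.natDegree ≤ n ∧ ∀ t : ℝ, 0 < t → φ (t • P) = p.eval (t : ℂ) := by
  classical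
  obtain ⟨p, hp⟩ := exists_poly_nsmul hs P hP φ hφ.2.1 hφ.2.2
  obtain ⟨M, hM⟩ := exists_norm_nsmul_le hφ P
  refine ⟨p, natDegree_le_of_norm_eval_le fun k hk => hp k ▸ hM k hk, ?_⟩
  have hrat : ∀ (k m : ℕ), 0 < m → φ (((k : ℝ) / m) • P) = p.eval (((k : ℝ) / m : ℝ) : ℂ) := by
    intro k m hm
    have hm' : (m : ℂ) ≠ 0 := by exact_mod_cast hm.ne'
    have hm'' : (m : ℝ) ≠ 0 := by exact_mod_cast hm.ne'
    obtain ⟨q, hq⟩ := exists_poly_nsmul (hs.image fun x => (m : ℝ)⁻¹ • x) ((m : ℝ)⁻¹ • P)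
      (by rw [coe_smul, hP, Finset.coe_image, Set.image_smul, convexHull_smul]) φ hφ.2.1 hφ.2.2
    have hqp : q.comp (C (m : ℂ) * X) = p := by
      refine Polynomial.eq_of_infinite_eval_eq _ _ ((Set.infinite_range_of_injective
        (Nat.cast_injective (R := ℂ))).mono ?_)
      rintro _ ⟨j, rfl⟩
      change eval _ _ = eval _ _
      rw [← hp, eval_comp, eval_mul, eval_C, eval_X, ← Nat.cast_mul, ← hq,
        ← natCast_smul_eq_nsmul, smul_smul, ← natCast_smul_eq_nsmul]
      congr 2
      push_cast
      field_simp
    rw [← hqp, eval_comp, eval_mul, eval_C, eval_X, div_eq_mul_inv, mul_smul,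
      natCast_smul_eq_nsmul, hq]
    congr 1
    push_cast
    field_simp
  intro t ht
  have hclosed : IsClosed {t : ℝ | φ (t • P) = p.eval (t : ℂ)} :=
    isClosed_eq (hφ.1.comp (continuous_smul_const_body P))
      (p.continuous.comp Complex.continuous_ofReal)
  have htend : Tendsto (fun m : ℕ => (⌊t * m⌋₊ : ℝ) / m) atTop (𝓝 t) :=
    (tendsto_nat_floor_mul_div_atTop ht.le).comp tendsto_natCast_atTop_atTop
  exact hclosed.mem_of_tendsto htend ((eventually_gt_atTop 0).mono fun m hm => hrat _ m hm)

/-- The coefficient of `X ^ i` in the Lagrange basis polynomial at the `k`-th of the nodes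
`1, …, n + 1`. -/
def lagrangeCoeff (n k i : ℕ) : ℂ :=
  (Lagrange.basis (Finset.range (n + 1)) (fun k : ℕ => (k : ℂ) + 1) k).coeff i

theorem sum_lagrangeCoeff_mul_eval {p : ℂ[X]} (hp : p.natDegree ≤ n) (i : ℕ) :
    ∑ k ∈ Finset.range (n + 1), lagrangeCoeff n k i * p.eval ((k : ℂ) + 1) = p.coeff i := by
  have h := Lagrange.eq_interpolate (s := Finset.range (n + 1)) (v := fun k : ℕ => (k : ℂ) + 1)
    (f := p) (fun a _ b _ h => by simpa using h)
    (by
      rw [Finset.card_range]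
      exact (degree_le_of_natDegree_le hp).trans_lt (by exact_mod_cast Nat.lt_succ_self n))
  conv_rhs => rw [h]
  simp [Lagrange.interpolate_apply, lagrangeCoeff, mul_comm]

theorem sum_lagrangeCoeff_mul_pow {i j : ℕ} (hj : j ≤ n) :
    ∑ k ∈ Finset.range (n + 1), lagrangeCoeff n k i * ((k : ℂ) + 1) ^ j =
      if i = j then 1 else 0 := by
  simpa [coeff_X_pow] using sum_lagrangeCoeff_mul_eval (p := X ^ j) (by simpa using hj) i

/-- **McMullen's decomposition**: the homogeneous components of a continuous translation invariant
valuation. -/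
theorem _root_.IsContTIVal.smul_eq_sum {φ : Body n → ℂ} (hφ : IsContTIVal φ) (K : Body n) {t : ℝ}
    (ht : 0 < t) :
    φ (t • K) = ∑ i ∈ Finset.range (n + 1),
      (∑ k ∈ Finset.range (n + 1), lagrangeCoeff n k i * φ (((k : ℝ) + 1) • K)) * (t : ℂ) ^ i := by
  refine dense_polytopes.induction (P := fun K => φ (t • K) = ∑ i ∈ Finset.range (n + 1),
    (∑ k ∈ Finset.range (n + 1), lagrangeCoeff n k i * φ (((k : ℝ) + 1) • K)) * (t : ℂ) ^ i)
    ?_ ?_ K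
  · rintro P ⟨s, hs, hP⟩
    obtain ⟨p, hpn, hp⟩ := exists_poly_smul hφ hs hP
    rw [hp t ht, eval_eq_sum_range' (Nat.lt_succ_of_le hpn)]
    refine Finset.sum_congr rfl fun i _ => ?_
    rw [← sum_lagrangeCoeff_mul_eval hpn]
    congr 1
    refine Finset.sum_congr rfl fun k _ => ?_
    rw [hp _ (by positivity)]
    push_cast
    rfl
  · refine isClosed_eq (hφ.1.comp (continuous_const_smul_body t)) ?_
    refine continuous_finsetSum _ fun i _ => Continuous.mul ?_ continuous_const
    exact continuous_finsetSum _ fun k _ =>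
      continuous_const.mul (hφ.1.comp (continuous_const_smul_body _))

theorem transBody_smul {t : ℝ} (x : En n) (K : Body n) :
    t • transBody x K = transBody (t • x) (t • K) := by
  rw [transBody_eq_point_add, transBody_eq_point_add, smul_add]
  congr 1
  exact ConvexBody.ext Set.smul_set_singleton

theorem _root_.IsValuation.comp_smul {φ : Body n → ℂ} (hφ : IsValuation φ) {t : ℝ} (ht : t ≠ 0) :
    IsValuation fun K => φ (t • K) := by
  intro K L U I hU hI
  refine hφ _ _ _ _ ?_ ?_
  · simp only [coe_smul, hU, Set.smul_set_union]
  · simp only [coe_smul, hI, Set.smul_set_inter₀ ht]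

/-- Dilating the arguments of a bivaluation by the factors `k + 1` and `l + 1`. -/
def dilateBi (k l : ℕ) : BValSub n →ₗ[ℂ] BValSub n where
  toFun φ := ⟨fun K L => φ.1 (((k : ℝ) + 1) • K) (((l : ℝ) + 1) • L), by
    obtain ⟨φ, hc, ⟨h₁, h₂⟩, ht⟩ := φ
    refine ⟨?_, ⟨fun L => (h₁ _).comp_smul (by positivity),
      fun K => (h₂ _).comp_smul (by positivity)⟩,
      fun x y K L => ?_⟩
    · exact hc.comp (((continuous_const_smul_body _).comp continuous_fst).prodMk
        ((continuous_const_smul_body _).comp continuous_snd))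
    · simp only [transBody_smul, ht _ _ _ _]⟩
  map_add' _ _ := rfl
  map_smul' _ _ := rfl

/-- The component of bidegree `(i, j)` of a bivaluation. -/
def component (i j : ℕ) : BValSub n →ₗ[ℂ] BValSub n :=
  ∑ k ∈ Finset.range (n + 1), ∑ l ∈ Finset.range (n + 1),
    (lagrangeCoeff n k i * lagrangeCoeff n l j) • dilateBi k l

theorem component_apply (i j : ℕ) (φ : BValSub n) (K L : Body n) :
    (component i j φ : Body n → Body n → ℂ) K L =
      ∑ k ∈ Finset.range (n + 1), ∑ l ∈ Finset.range (n + 1),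
        lagrangeCoeff n k i * lagrangeCoeff n l j *
          (φ : Body n → Body n → ℂ) (((k : ℝ) + 1) • K) (((l : ℝ) + 1) • L) := by
  simp [component, dilateBi, LinearMap.sum_apply, Finset.sum_apply]

theorem smul_smul_eq_sum_component (φ : BValSub n) (K L : Body n) {s t : ℝ} (ht : 0 < t)
    (hs : 0 < s) :
    (φ : Body n → Body n → ℂ) (t • K) (s • L) =
      ∑ i ∈ Finset.range (n + 1), ∑ j ∈ Finset.range (n + 1),
        (component i j φ : Body n → Body n → ℂ) K L * (t : ℂ) ^ i * (s : ℂ) ^ j := by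
  obtain ⟨φ, hφ⟩ := φ
  have hcont := hφ.1
  have h0 : ∀ K : Body n, transBody 0 K = K := fun K => ConvexBody.ext (by simp [transBody])
  have h₁ : ∀ L, IsContTIVal fun K => φ K L := fun L =>
    ⟨hcont.comp (continuous_id.prodMk continuous_const), hφ.2.1.1 L,
      fun x K => by simpa [h0] using hφ.2.2 x 0 K L⟩
  have h₂ : ∀ K, IsContTIVal (φ K) := fun K =>
    ⟨hcont.comp (continuous_const.prodMk continuous_id), hφ.2.1.2 K,
      fun x L => by simpa [h0] using hφ.2.2 0 x K L⟩
  simp only [component_apply]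
  rw [(h₁ _).smul_eq_sum K ht]
  refine Finset.sum_congr rfl fun i _ => ?_
  simp only [Finset.sum_mul]
  rw [Finset.sum_comm]
  refine Finset.sum_congr rfl fun k _ => ?_
  rw [(h₂ _).smul_eq_sum L hs]
  simp only [Finset.mul_sum, Finset.sum_mul]
  refine Finset.sum_congr rfl fun j _ => Finset.sum_congr rfl fun l _ => ?_
  ring

theorem sum_component (φ : BValSub n) :
    ∑ i ∈ Finset.range (n + 1), ∑ j ∈ Finset.range (n + 1), component i j φ = φ := by
  ext K L
  have := smul_smul_eq_sum_component φ K L one_pos one_pos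
  simp only [one_smul, Complex.ofReal_one, one_pow, mul_one] at this
  simp [this, Finset.sum_apply]

theorem sum_lagrangeCoeff_mul_sum_pow {i : ℕ} (hi : i ≤ n) (b : ℕ → ℂ) :
    ∑ k ∈ Finset.range (n + 1), lagrangeCoeff n k i *
      ∑ j ∈ Finset.range (n + 1), b j * ((k : ℂ) + 1) ^ j = b i := by
  simp only [Finset.mul_sum, mul_left_comm _ (b _)]
  rw [Finset.sum_comm]
  simp only [← Finset.mul_sum]
  rw [Finset.sum_eq_single i]
  · rw [sum_lagrangeCoeff_mul_pow hi, if_pos rfl, mul_one]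
  · intro j hj hji
    rw [sum_lagrangeCoeff_mul_pow (Finset.mem_range_succ_iff.1 hj), if_neg hji.symm, mul_zero]
  · exact fun h => (h (Finset.mem_range_succ_iff.2 hi)).elim

theorem component_mem {i j : ℕ} (hi : i ≤ n) (hj : j ≤ n) (φ : BValSub n) :
    component i j φ ∈ BValIJ n i j := by
  intro t s ht hs K L
  have key : ∀ k l : ℕ, (φ : Body n → Body n → ℂ) (((k : ℝ) + 1) • t • K) (((l : ℝ) + 1) • s • L) =
      ∑ i' ∈ Finset.range (n + 1), (∑ j' ∈ Finset.range (n + 1),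
        (component i' j' φ : Body n → Body n → ℂ) K L * (t : ℂ) ^ i' * (s : ℂ) ^ j' *
          ((l : ℂ) + 1) ^ j') * ((k : ℂ) + 1) ^ i' := by
    intro k l
    rw [smul_smul, smul_smul, smul_smul_eq_sum_component φ K L (by positivity) (by positivity)]
    refine Finset.sum_congr rfl fun i' _ => ?_
    rw [Finset.sum_mul]
    refine Finset.sum_congr rfl fun j' _ => ?_
    push_cast
    rw [mul_pow, mul_pow]
    ring
  change (component i j φ : Body n → Body n → ℂ) (t • K) (s • L) = _
  rw [component_apply, Finset.sum_comm]
  simp only [key, mul_right_comm _ (lagrangeCoeff n _ j)]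
  simp only [mul_comm (lagrangeCoeff n _ i * _) (lagrangeCoeff n _ j),
    ← Finset.mul_sum, sum_lagrangeCoeff_mul_sum_pow hi]
  rw [sum_lagrangeCoeff_mul_sum_pow hj, Complex.real_smul]
  push_cast
  ring

theorem component_of_mem {i' j' : ℕ} (hi : i' ≤ n) (hj : j' ≤ n) {φ : BValSub n}
    (hφ : φ ∈ BValIJ n i' j') (i j : ℕ) :
    component i j φ = if i = i' ∧ j = j' then φ else 0 := by
  ext K L
  have key : ∀ k l : ℕ, (φ : Body n → Body n → ℂ) (((k : ℝ) + 1) • K) (((l : ℝ) + 1) • L) =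
      ((k : ℂ) + 1) ^ i' * ((l : ℂ) + 1) ^ j' * (φ : Body n → Body n → ℂ) K L := by
    intro k l
    refine (hφ ((k : ℝ) + 1) ((l : ℝ) + 1) (by positivity) (by positivity) K L).trans ?_
    rw [Complex.real_smul]
    push_cast
    rfl
  have hsum : (component i j φ : Body n → Body n → ℂ) K L =
      (∑ k ∈ Finset.range (n + 1), lagrangeCoeff n k i * ((k : ℂ) + 1) ^ i') *
        (∑ l ∈ Finset.range (n + 1), lagrangeCoeff n l j * ((l : ℂ) + 1) ^ j') *
          (φ : Body n → Body n → ℂ) K L := by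
    rw [component_apply, Finset.sum_mul_sum]
    simp only [key, Finset.sum_mul]
    refine Finset.sum_congr rfl fun k _ => Finset.sum_congr rfl fun l _ => ?_
    ring
  rw [hsum, sum_lagrangeCoeff_mul_pow hi, sum_lagrangeCoeff_mul_pow hj]
  by_cases h₁ : i = i' <;> by_cases h₂ : j = j' <;> simp [h₁, h₂]

end ConvexBody

/-- **Corollary 6.1 (McMullen decomposition for bivaluations).**
`BVal = ⊕_{i,j=0}^n BVal_{i,j}`. -/
theorem bval_direct_sum_decomposition (n : ℕ) (hn : 3 ≤ n) :
    DirectSum.IsInternal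
      (fun p : Fin (n + 1) × Fin (n + 1) => BValIJ n (p.1 : ℕ) (p.2 : ℕ)) := by
  refine DirectSum.isInternal_submodule_of_iSupIndep_of_iSup_eq_top (fun p => ?_) ?_
  · rw [Submodule.disjoint_def]
    intro φ hφ hφ'
    have hker : ⨆ q, ⨆ (_ : q ≠ p), BValIJ n (q.1 : ℕ) (q.2 : ℕ) ≤
        LinearMap.ker (ConvexBody.component (n := n) p.1 p.2) := by
      refine iSup₂_le fun q hq ψ hψ => ?_
      rw [LinearMap.mem_ker, ConvexBody.component_of_mem q.1.is_le q.2.is_le hψ, if_neg]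
      exact fun h => hq (Prod.ext (Fin.ext h.1.symm) (Fin.ext h.2.symm))
    have h := LinearMap.mem_ker.1 (hker hφ')
    rwa [ConvexBody.component_of_mem p.1.is_le p.2.is_le hφ, if_pos ⟨rfl, rfl⟩] at h
  · refine eq_top_iff.2 fun φ _ => ?_
    rw [← ConvexBody.sum_component φ]
    refine Submodule.sum_mem _ fun i hi => Submodule.sum_mem _ fun j hj => ?_
    rw [Finset.mem_range] at hi hj
    exact Submodule.mem_iSup_of_mem
      (p := fun p : Fin (n + 1) × Fin (n + 1) => BValIJ n (p.1 : ℕ) (p.2 : ℕ))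
      (⟨i, hi⟩, ⟨j, hj⟩)
      (ConvexBody.component_mem (Nat.le_of_lt_succ hi) (Nat.le_of_lt_succ hj) φ)
end
end

section
/- Let k ∈ ℕ and set i = 2k+1 and n = 4k+2, with n ≥ 3. Then there exist a continuous translation biinvariant SO(n) invariant bivaluation ζ ∈ BVal_{i,i} of bidegree (i,i) on convex bodies in an n-dimensional Euclidean vector space and convex bodies K, L ∈ K^n such that ζ(K,L) ≠ ζ(L,K). -/
open scoped Pointwise NNReal
noncomputable section

section

open MeasureTheory

/-- The integral over a compact set of a jointly continuous function depends continuously on the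
parameter; no countability or local compactness of the parameter space is needed. -/
theorem continuous_setIntegral_of_isCompact {X Y E : Type*} [TopologicalSpace X]
    [TopologicalSpace Y] [MeasurableSpace Y] [NormedAddCommGroup E] [NormedSpace ℝ E]
    {μ : Measure Y} [IsFiniteMeasureOnCompacts μ]
    {k : Set Y} (hk : IsCompact k) {f : X → Y → E} (hf : Continuous (Function.uncurry f))
    (hint : ∀ x, IntegrableOn (f x) k μ) :
    Continuous fun x => ∫ y in k, f x y ∂μ := by
  rw [continuous_iff_continuousAt]
  intro x₀
  rw [ContinuousAt, Metric.tendsto_nhds]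
  intro ε hε
  set M := μ.real k with hM
  have hM0 : 0 ≤ M := measureReal_nonneg
  have hδ : 0 < ε / (M + 1) := by positivity
  have key : ∀ᶠ x in nhds x₀, ∀ y ∈ k, ‖f x y - f x₀ y‖ < ε / (M + 1) := by
    apply hk.eventually_forall_of_forall_eventually
    intro y _
    have hc : Continuous fun p : X × Y => ‖f p.1 p.2 - f x₀ p.2‖ :=
      (hf.sub (hf.comp (continuous_const.prodMk continuous_snd))).norm
    have := hc.continuousAt (x := (x₀, y))
    exact this.eventually (gt_mem_nhds (by simpa using hδ))
  filter_upwards [key] with x hx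
  rw [dist_eq_norm, ← integral_sub (hint x) (hint x₀)]
  have hlt : ε / (M + 1) * M < ε := by
    rw [div_mul_eq_mul_div, div_lt_iff₀ (by positivity)]
    nlinarith
  refine lt_of_le_of_lt ?_ hlt
  exact norm_setIntegral_le_of_norm_le_const hk.measure_lt_top fun y hy => (hx y hy).le

/-- The uniform measure on the unit ball. -/
def ballMeasure (n : ℕ) : Measure (En n) := volume.restrict (Metric.closedBall 0 1)

instance (n : ℕ) : IsFiniteMeasure (ballMeasure n) :=
  ⟨by simpa [ballMeasure] using (isCompact_closedBall (0 : En n) 1).measure_lt_top⟩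

/-- The product of `d` copies of the uniform measure on the unit ball. -/
def framesMeasure (d n : ℕ) : Measure (Fin d → En n) := Measure.pi fun _ => ballMeasure n

instance (d n : ℕ) : IsFiniteMeasure (framesMeasure d n) := by
  unfold framesMeasure; infer_instance

theorem framesMeasure_eq (d n : ℕ) : framesMeasure d n =
    volume.restrict (Set.univ.pi fun _ : Fin d => Metric.closedBall (0 : En n) 1) := by
  rw [framesMeasure, volume_pi, Measure.restrict_pi_pi]
  rfl

theorem isCompact_pi_closedBall (d n : ℕ) :
    IsCompact (Set.univ.pi fun _ : Fin d => Metric.closedBall (0 : En n) 1) :=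
  isCompact_univ_pi fun _ => isCompact_closedBall _ _

theorem integrable_ballMeasure {n : ℕ} {E : Type*} [NormedAddCommGroup E] {f : En n → E}
    (hf : Continuous f) : Integrable f (ballMeasure n) :=
  hf.continuousOn.integrableOn_compact (isCompact_closedBall _ _)

theorem integrable_framesMeasure {d n : ℕ} {E : Type*} [NormedAddCommGroup E]
    {f : (Fin d → En n) → E} (hf : Continuous f) : Integrable f (framesMeasure d n) := by
  rw [framesMeasure_eq]
  exact hf.continuousOn.integrableOn_compact (isCompact_pi_closedBall d n)

theorem continuous_integral_framesMeasure {d n : ℕ} {X E : Type*} [TopologicalSpace X]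
    [NormedAddCommGroup E] [NormedSpace ℝ E] {f : X → (Fin d → En n) → E}
    (hf : Continuous (Function.uncurry f)) :
    Continuous fun x => ∫ y, f x y ∂framesMeasure d n := by
  rw [framesMeasure_eq]
  exact continuous_setIntegral_of_isCompact (isCompact_pi_closedBall d n) hf fun x =>
    (hf.comp (continuous_const.prodMk continuous_id)).continuousOn.integrableOn_compact
      (isCompact_pi_closedBall d n)

theorem measurePreserving_ballMeasure {n : ℕ} (e : En n ≃ₗᵢ[ℝ] En n) :
    MeasurePreserving e (ballMeasure n) (ballMeasure n) := by
  have h := e.measurePreserving.restrict_preimage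
    (s := Metric.closedBall (0 : En n) 1) Metric.isClosed_closedBall.measurableSet
  rwa [LinearIsometryEquiv.preimage_closedBall, map_zero] at h

theorem integral_ballMeasure_comp {n : ℕ} {E : Type*} [NormedAddCommGroup E] [NormedSpace ℝ E]
    (e : En n ≃ₗᵢ[ℝ] En n) (f : En n → E) :
    ∫ x, f (e x) ∂ballMeasure n = ∫ x, f x ∂ballMeasure n :=
  (measurePreserving_ballMeasure e).integral_comp e.toHomeomorph.measurableEmbedding f

theorem integral_framesMeasure_succ {d n : ℕ} {E : Type*} [NormedAddCommGroup E]
    [NormedSpace ℝ E] {f : (Fin (d + 1) → En n) → E} (hf : Continuous f) :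
    ∫ G, f G ∂framesMeasure (d + 1) n =
      ∫ g, ∫ G, f (Fin.cons g G) ∂framesMeasure d n ∂ballMeasure n := by
  have h := (measurePreserving_piFinSuccAbove (fun _ : Fin (d + 1) => ballMeasure n) 0).symm
  have hc : Continuous fun p : En n × (Fin d → En n) => f (Fin.cons p.1 p.2) := by
    refine hf.comp (continuous_pi fun i => ?_)
    refine Fin.cases ?_ (fun j => ?_) i
    · simpa using continuous_fst
    · simp only [Fin.cons_succ]
      fun_prop
  have hi : Integrable (fun p : En n × (Fin d → En n) => f (Fin.cons p.1 p.2))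
      ((ballMeasure n).prod (framesMeasure d n)) := by
    rw [framesMeasure_eq, ballMeasure, Measure.prod_restrict]
    exact hc.continuousOn.integrableOn_compact
      ((isCompact_closedBall _ _).prod (isCompact_pi_closedBall d n))
  rw [← integral_prod _ hi]
  rw [framesMeasure, ← h.integral_comp (MeasurableEquiv.measurableEmbedding _)]
  congr 1
  funext x
  simp [MeasurableEquiv.piFinSuccAbove, Fin.insertNthEquiv]

namespace ConvexBody

variable {V W : Type*} [NormedAddCommGroup V] [NormedSpace ℝ V] [NormedAddCommGroup W]
  [NormedSpace ℝ W]

theorem exists_dist_lt {K L : ConvexBody V} {ε : ℝ} (h : dist K L < ε) {x : V} (hx : x ∈ K) :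
    ∃ y ∈ L, dist x y < ε :=
  Metric.exists_dist_lt_of_hausdorffDist_lt hx h hausdorffEDist_ne_top

theorem mem_of_closedBall_subset {K L : ConvexBody V} {x : V} {r : ℝ}
    (hr : Metric.closedBall x r ⊆ (K : Set V)) (h : dist K L < r / 2) : x ∈ L := by
  have hr0 : 0 < r := by linarith [dist_nonneg (x := K) (y := L)]
  by_contra hx
  obtain ⟨f, u, hfx, hfL⟩ := geometric_hahn_banach_point_closed L.convex L.isClosed hx
  have hf : 0 < ‖f‖ := by
    rw [norm_pos_iff]
    rintro rfl
    obtain ⟨y, hy⟩ := L.nonempty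
    have := hfL y hy
    simp at this hfx
    linarith
  obtain ⟨v, hv1, hv⟩ := f.exists_lt_apply_of_lt_opNorm (r := ‖f‖ / 2) (by linarith)
  obtain ⟨w, hw1, hw⟩ : ∃ w : V, ‖w‖ < 1 ∧ f w < -(‖f‖ / 2) := by
    rcases le_total 0 (f v) with h0 | h0
    · exact ⟨-v, by simpa using hv1, by
        rw [Real.norm_of_nonneg h0] at hv; simp; linarith⟩
    · exact ⟨v, hv1, by rw [Real.norm_of_nonpos h0] at hv; linarith⟩
  have hp : x + r • w ∈ (K : Set V) := hr (by
    simp [norm_smul, abs_of_pos hr0]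
    nlinarith)
  obtain ⟨y, hy, hd⟩ := exists_dist_lt h hp
  have h1 : f y - f (x + r • w) ≤ ‖f‖ * (r / 2) := by
    rw [← map_sub]
    refine (le_abs_self _).trans ((f.le_opNorm _).trans ?_)
    gcongr
    rw [dist_comm, dist_eq_norm] at hd
    exact hd.le
  have h2 := hfL y hy
  simp only [map_add, map_smul, smul_eq_mul] at h1
  nlinarith

/-- The volume of convex bodies is continuous with respect to the Hausdorff metric. -/
theorem continuous_measureReal [FiniteDimensional ℝ V] [MeasurableSpace V] [BorelSpace V]
    (μ : Measure V) [μ.IsAddHaarMeasure] :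
    Continuous fun K : ConvexBody V => μ.real (K : Set V) := by
  have : ProperSpace V := FiniteDimensional.proper ℝ V
  rw [continuous_iff_continuousAt]
  intro K
  have hind : ∀ L : ConvexBody V,
      μ.real (L : Set V) = ∫ x, (L : Set V).indicator (fun _ => (1 : ℝ)) x ∂μ := fun L => by
    rw [integral_indicator_const _ L.isClosed.measurableSet]; simp
  simp only [ContinuousAt, hind]
  obtain ⟨R, hR⟩ := K.isBounded.subset_closedBall (0 : V)
  refine tendsto_integral_filter_of_dominated_convergence
    ((Metric.closedBall (0 : V) (R + 1)).indicator fun _ => (1 : ℝ)) ?_ ?_ ?_ ?_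
  · exact .of_forall fun L =>
      (measurable_const.indicator L.isClosed.measurableSet).aestronglyMeasurable
  · filter_upwards [Metric.ball_mem_nhds K one_pos] with L hL
    refine .of_forall fun x => ?_
    simp only [norm_indicator_eq_indicator_norm, norm_one]
    refine Set.indicator_le_indicator_of_subset (fun y hy => ?_) (fun _ => zero_le_one) x
    obtain ⟨z, hz, hd⟩ := exists_dist_lt hL hy
    have := hR hz
    rw [Metric.mem_closedBall] at this ⊢
    linarith [dist_triangle y z 0]
  · exact (integrable_indicator_iff Metric.isClosed_closedBall.measurableSet).2
      (integrableOn_const (isCompact_closedBall _ _).measure_ne_top)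
  · have hfr : ∀ᵐ x ∂μ, x ∉ frontier (K : Set V) :=
      measure_eq_zero_iff_ae_notMem.1 (K.convex.addHaar_frontier μ)
    filter_upwards [hfr] with x hx
    apply tendsto_const_nhds.congr'
    by_cases hxK : x ∈ (K : Set V)
    · have hxi : x ∈ interior (K : Set V) := by
        by_contra h
        exact hx ⟨subset_closure hxK, h⟩
      obtain ⟨r, hr, hb⟩ := Metric.nhds_basis_closedBall.mem_iff.1 (mem_interior_iff_mem_nhds.1 hxi)
      filter_upwards [Metric.ball_mem_nhds K (half_pos hr)] with L hL
      have : x ∈ (L : Set V) := mem_of_closedBall_subset hb (by rwa [dist_comm])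
      simp [hxK, this]
    · obtain ⟨r, hr, hb⟩ := Metric.isOpen_iff.1 K.isClosed.isOpen_compl x hxK
      filter_upwards [Metric.ball_mem_nhds K hr] with L hL
      have : x ∉ (L : Set V) := fun h => by
        obtain ⟨z, hz, hd⟩ := exists_dist_lt hL h
        exact hb (by rwa [Metric.mem_ball, dist_comm]) hz
      simp [hxK, this]

/-- The image of a convex body under a continuous linear map. -/
def linearImage (A : V →L[ℝ] W) (K : ConvexBody V) : ConvexBody W where
  carrier := A '' (K : Set V)
  convex' := K.convex.linear_image A.toLinearMap
  isCompact' := K.isCompact.image A.continuous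
  nonempty' := K.nonempty.image _

theorem continuous_linearImage :
    Continuous fun p : (V →L[ℝ] W) × ConvexBody V => linearImage p.1 p.2 := by
  rw [continuous_iff_continuousAt]
  rintro ⟨A₀, K₀⟩
  rw [ContinuousAt, Metric.tendsto_nhds]
  intro ε hε
  obtain ⟨R, hR0, hR⟩ : ∃ R, 0 < R ∧ ∀ x ∈ K₀, ‖x‖ ≤ R := K₀.isBounded.exists_pos_norm_le
  set δ := min 1 (ε / 2 / (R + (‖A₀‖ + 1))) with hδ
  have hδ0 : 0 < δ := lt_min one_pos (by positivity)
  have hδε : δ * R + (‖A₀‖ + 1) * δ ≤ ε / 2 := by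
    have : δ ≤ ε / 2 / (R + (‖A₀‖ + 1)) := min_le_right _ _
    rw [le_div_iff₀ (by positivity)] at this
    linarith
  filter_upwards [Metric.ball_mem_nhds (A₀, K₀) hδ0] with p hp
  obtain ⟨A, K⟩ := p
  rw [Metric.mem_ball, Prod.dist_eq, max_lt_iff] at hp
  obtain ⟨hA, hK⟩ := hp
  dsimp only at hA hK ⊢
  have hA' : ‖A - A₀‖ < δ := by rwa [← dist_eq_norm]
  have hAn : ‖A‖ ≤ ‖A₀‖ + 1 := by
    have := norm_le_norm_add_norm_sub' A A₀
    linarith [min_le_left 1 (ε / 2 / (R + (‖A₀‖ + 1)))]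
  have hest : ∀ x, ∀ x' ∈ K₀, dist x x' < δ → dist (A x) (A₀ x') ≤ ε / 2 := by
    intro x x' hx' hd
    have heq : A x - A₀ x' = (A - A₀) x' + A (x - x') := by
      simp only [sub_apply, map_sub]; abel
    rw [dist_eq_norm, heq]
    refine (norm_add_le _ _).trans (le_trans ?_ hδε)
    refine add_le_add (((A - A₀).le_opNorm x').trans ?_) ((A.le_opNorm _).trans ?_)
    · exact mul_le_mul hA'.le (hR x' hx') (norm_nonneg _) hδ0.le
    · rw [dist_eq_norm] at hd
      exact mul_le_mul hAn hd.le (norm_nonneg _) (by positivity)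
  refine lt_of_le_of_lt ?_ (half_lt_self hε)
  rw [← hausdorffDist_coe]
  refine Metric.hausdorffDist_le_of_mem_dist (by positivity) ?_ ?_
  · rintro _ ⟨x, hx, rfl⟩
    obtain ⟨x', hx', hd⟩ := exists_dist_lt hK hx
    exact ⟨A₀ x', ⟨x', hx', rfl⟩, hest x x' hx' hd⟩
  · rintro _ ⟨x', hx', rfl⟩
    obtain ⟨x, hx, hd⟩ := exists_dist_lt (by rwa [dist_comm]) hx'
    exact ⟨A x, ⟨x, hx, rfl⟩, by rw [dist_comm]; exact hest x x' hx' (by rwa [dist_comm])⟩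

theorem image_inter_of_convex_union {K L : ConvexBody V} (h : Convex ℝ ((K : Set V) ∪ L))
    (A : V →L[ℝ] W) : A '' ((K : Set V) ∩ L) = A '' (K : Set V) ∩ A '' (L : Set V) := by
  refine (Set.image_inter_subset _ _ _).antisymm ?_
  rintro _ ⟨⟨x, hx, rfl⟩, ⟨y, hy, hxy⟩⟩
  have hsub := h.segment_subset (.inl hx) (.inr hy)
  obtain ⟨z, hz, hzKL⟩ := isPreconnected_closed_iff.1 (convex_segment x y).isPreconnected
    _ _ K.isClosed L.isClosed hsub ⟨x, left_mem_segment _ _ _, hx⟩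
    ⟨y, right_mem_segment _ _ _, hy⟩
  refine ⟨z, hzKL, ?_⟩
  obtain ⟨a, b, ha, hb, hab, rfl⟩ := hz
  rw [map_add, map_smul, map_smul, hxy, ← add_smul, hab, one_smul]

end ConvexBody

/-- The linear map to `ℝ^d` whose components are the inner products with the vectors `G r`. -/
def rowMap {d n : ℕ} (G : Fin d → En n) : En n →L[ℝ] (Fin d → ℝ) :=
  ContinuousLinearMap.pi fun r => innerSL ℝ (G r)

theorem rowMap_apply {d n : ℕ} (G : Fin d → En n) (v : En n) (r : Fin d) :
    rowMap G v r = inner ℝ (G r) v := rfl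

theorem continuous_rowMap {d n : ℕ} : Continuous (rowMap (d := d) (n := n)) := by
  rw [continuous_clm_apply]
  intro v
  refine continuous_pi fun r => ?_
  simp only [rowMap_apply]
  fun_prop

/-- The `d`-dimensional volume of the image of a body under `rowMap G`. -/
def imageVol {d n : ℕ} (G : Fin d → En n) (K : Body n) : ℝ :=
  volume.real (rowMap G '' (K : Set (En n)))

theorem continuous_imageVol {d n : ℕ} :
    Continuous fun p : (Fin d → En n) × Body n => imageVol p.1 p.2 :=
  (ConvexBody.continuous_measureReal (V := Fin d → ℝ) volume).comp
    (ConvexBody.continuous_linearImage.comp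
      ((continuous_rowMap.comp continuous_fst).prodMk continuous_snd))

theorem isValuation_imageVol {d n : ℕ} (G : Fin d → En n) : IsValuation (imageVol G) := by
  intro K L U I hU hI
  have hc : Convex ℝ ((K : Set (En n)) ∪ L) := hU ▸ U.convex
  simp only [imageVol, hU, hI, Set.image_union, ConvexBody.image_inter_of_convex_union hc]
  have hK := K.isCompact.image (rowMap G).continuous
  have hL := L.isCompact.image (rowMap G).continuous
  exact (measureReal_union_add_inter hL.isClosed.measurableSet hK.measure_ne_top
    hL.measure_ne_top).symm

theorem imageVol_transBody {d n : ℕ} (G : Fin d → En n) (x : En n) (K : Body n) :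
    imageVol G (transBody x K) = imageVol G K := by
  have h : rowMap G '' (transBody x K : Set (En n)) =
      (fun y => rowMap G x + y) '' (rowMap G '' (K : Set (En n))) := by
    change rowMap G '' ((fun y => x + y) '' (K : Set (En n))) = _
    simp only [Set.image_image, map_add]
  rw [imageVol, h, imageVol, measureReal_def, measureReal_def, Set.image_add_left,
    measure_preimage_add]

theorem imageVol_scaleBody {d n : ℕ} (G : Fin d → En n) {t : ℝ} (ht : 0 < t) (K : Body n) :
    imageVol G (scaleBody t K) = t ^ d * imageVol G K := by
  have h : rowMap G '' (scaleBody t K : Set (En n)) = t • (rowMap G '' (K : Set (En n))) := by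
    change rowMap G '' (t • (K : Set (En n))) = _
    rw [image_smul_set]
  rw [imageVol, h, imageVol, measureReal_def, measureReal_def, Measure.addHaar_smul]
  simp [abs_of_pos ht, ht.le]

/-- The parallelepiped spanned by the vectors `a s`. -/
def boxBody {d n : ℕ} (a : Fin d → En n) : Body n :=
  ConvexBody.linearImage (LinearMap.toContinuousLinearMap (Fintype.linearCombination ℝ a))
    { carrier := Set.Icc (0 : Fin d → ℝ) 1
      convex' := convex_Icc _ _
      isCompact' := isCompact_Icc
      nonempty' := ⟨0, by simp⟩ }

theorem imageVol_boxBody {d n : ℕ} (G a : Fin d → En n) :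
    imageVol G (boxBody a) = |(Matrix.of fun r s => inner ℝ (G r) (a s)).det| := by
  have h : rowMap G '' (boxBody a : Set (En n)) =
      Matrix.toLin' (Matrix.of fun r s => inner ℝ (G r) (a s)) '' Set.Icc 0 1 := by
    change rowMap G '' ((Fintype.linearCombination ℝ a) '' Set.Icc 0 1) = _
    rw [Set.image_image]
    refine Set.image_congr fun t _ => ?_
    ext r
    simp [rowMap_apply, Fintype.linearCombination_apply, inner_sum, inner_smul_right,
      Matrix.mulVec, dotProduct, mul_comm]
  rw [imageVol, h, measureReal_def, Measure.addHaar_image_linearMap, LinearMap.det_toLin',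
    Real.volume_Icc_pi]
  simp

/-- An alternating form is isotropic if contracting one slot of two copies of it against the
metric gives zero. -/
def IsIsotropic {m n : ℕ} (ψ : En n [⋀^Fin m]→L[ℝ] ℂ) : Prop :=
  ∀ (B : OrthonormalBasis (Fin n) ℝ (En n)) (i : Fin m) (v w : Fin m → En n),
    ∑ j, ψ (Function.update v i (B j)) * ψ (Function.update w i (B j)) = 0

theorem IsIsotropic.curryLeft {m n : ℕ} {ψ : En n [⋀^Fin (m + 1)]→L[ℝ] ℂ} (h : IsIsotropic ψ)
    (x : En n) : IsIsotropic (ψ.curryLeft x) := by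
  intro B i v w
  simpa only [ContinuousAlternatingMap.curryLeft_apply_apply, Matrix.vecCons, Fin.cons_update]
    using h B i.succ (Fin.cons x v) (Fin.cons x w)

theorem IsIsotropic.sum_cons {m n : ℕ} {ψ : En n [⋀^Fin (m + 1)]→L[ℝ] ℂ} (h : IsIsotropic ψ)
    (B : OrthonormalBasis (Fin n) ℝ (En n)) (v w : Fin m → En n) :
    ∑ j, ψ (Fin.cons (B j) v) * ψ (Fin.cons (B j) w) = 0 := by
  simpa only [Fin.update_cons_zero] using h B 0 (Fin.cons 0 v) (Fin.cons 0 w)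

/-- The linear isometry sending the standard basis to the orthonormal family `a`. -/
def frameIsometry {m n : ℕ} {a : Fin m → En n} (ha : Orthonormal ℝ a) : En m →ₗᵢ[ℝ] En n :=
  LinearMap.isometryOfOrthonormal (v := (EuclideanSpace.basisFun (Fin m) ℝ).toBasis)
    ((EuclideanSpace.basisFun (Fin m) ℝ).toBasis.constr ℝ a)
    (by simp)
    (by
      convert ha
      funext s
      exact Module.Basis.constr_basis _ _ _ _)

theorem frameIsometry_apply {m n : ℕ} {a : Fin m → En n} (ha : Orthonormal ℝ a) (x : En m) :
    frameIsometry ha x = ∑ s, x s • a s := by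
  change (EuclideanSpace.basisFun (Fin m) ℝ).toBasis.constr ℝ a x = _
  simp [Module.Basis.constr_apply_fintype]

theorem exists_orthonormalBasis_eq_norm_smul {m : ℕ} (ξ : En (m + 1)) :
    ∃ β : OrthonormalBasis (Fin (m + 1)) ℝ (En (m + 1)), ξ = ‖ξ‖ • β 0 := by
  rcases eq_or_ne ξ 0 with rfl | h
  · exact ⟨EuclideanSpace.basisFun _ ℝ, by simp⟩
  · have ho : Orthonormal ℝ (({0} : Set (Fin (m + 1))).domRestrict fun _ => ‖ξ‖⁻¹ • ξ) := by
      refine ⟨fun i => ?_, fun i j hij => absurd (Subsingleton.elim i j) hij⟩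
      simp [norm_smul, h]
    obtain ⟨β, hβ⟩ := ho.exists_orthonormalBasis_extension_of_card_eq (by simp)
    refine ⟨β, ?_⟩
    rw [hβ 0 rfl, smul_smul, mul_inv_cancel₀ (by simpa using h), one_smul]

theorem sq_map_orthonormalBasis {m : ℕ} (f : En m [⋀^Fin m]→L[ℝ] ℂ)
    (β γ : OrthonormalBasis (Fin m) ℝ (En m)) : f β ^ 2 = f γ ^ 2 := by
  have hre := congrArg (fun h => h β) ((Complex.reCLM.compContinuousAlternatingMap
    f).toAlternatingMap.eq_smul_basis_det γ.toBasis)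
  have him := congrArg (fun h => h β) ((Complex.imCLM.compContinuousAlternatingMap
    f).toAlternatingMap.eq_smul_basis_det γ.toBasis)
  simp at hre him
  rcases γ.det_to_matrix_orthonormalBasis_real β with h | h
  · rw [show f β = f γ from Complex.ext (by simp [hre, h]) (by simp [him, h])]
  · rw [show f β = -f γ from Complex.ext (by simp [hre, h]) (by simp [him, h]), neg_sq]

theorem abs_det_cons_eq {m n : ℕ} {a : Fin (m + 1) → En n} (ha : Orthonormal ℝ a)
    {ξ : En (m + 1)} {β : OrthonormalBasis (Fin (m + 1)) ℝ (En (m + 1))} (hξ : ξ = ‖ξ‖ • β 0)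
    (G : Fin m → En n) :
    |(Matrix.of (Fin.cons ξ fun r s => inner ℝ (G r) (a s)) :
        Matrix (Fin (m + 1)) (Fin (m + 1)) ℝ).det| =
      ‖ξ‖ * |(Matrix.of fun r (s : Fin m) =>
        inner ℝ (G r) (frameIsometry ha (β s.succ))).det| := by
  set A : Matrix (Fin (m + 1)) (Fin (m + 1)) ℝ :=
    Matrix.of (Fin.cons ξ fun r s => inner ℝ (G r) (a s)) with hA
  set R : Matrix (Fin (m + 1)) (Fin (m + 1)) ℝ := Matrix.of fun s t => β t s with hR
  have hRdet : |R.det| = 1 := by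
    have := (EuclideanSpace.basisFun (Fin (m + 1)) ℝ).det_to_matrix_orthonormalBasis β
    rw [Module.Basis.det_apply] at this
    rw [← Real.norm_eq_abs, ← this]
    congr 3
  have h0 : ∀ t, (A * R) 0 t = if t = 0 then ‖ξ‖ else 0 := by
    intro t
    have : (A * R) 0 t = inner ℝ (β t) ξ := by
      simp [Matrix.mul_apply, hA, hR, PiLp.inner_apply]
    rw [this, hξ, inner_smul_right, β.inner_eq_ite, ← hξ]
    simp
  have h1 : ∀ r t, (A * R) (Fin.succ r) t = inner ℝ (G r) (frameIsometry ha (β t)) := by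
    intro r t
    simp [Matrix.mul_apply, hA, hR, frameIsometry_apply, inner_sum, inner_smul_right, mul_comm]
  calc |A.det| = |(A * R).det| := by rw [Matrix.det_mul, abs_mul, hRdet, mul_one]
    _ = _ := by
      rw [Matrix.det_succ_row_zero, Fin.sum_univ_succ]
      simp only [h0]
      simp only [Fin.succ_ne_zero, if_true, if_false, mul_zero, zero_mul, Finset.sum_const_zero,
        add_zero, abs_mul, abs_norm]
      simp only [Fin.val_zero, pow_zero, abs_one, one_mul]
      congr 3
      ext r t
      simp [h1]

/-- The integral of a square of an isotropic form against the absolute value of a determinant, as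
a multiple of the square of the form. -/
def FrameIntegralEq (m n : ℕ) (c : ℝ) : Prop :=
  ∀ a : Fin m → En n, Orthonormal ℝ a → ∀ ψ : En n [⋀^Fin m]→L[ℝ] ℂ, IsIsotropic ψ →
    ∫ G, ((|(Matrix.of fun r s => inner ℝ (G r) (a s)).det| : ℝ) : ℂ) * ψ G ^ 2
      ∂framesMeasure m n = c * ψ a ^ 2

theorem continuous_abs_det_inner {m n : ℕ} (a : Fin m → En n) : Continuous fun G : Fin m → En n =>
    ((|(Matrix.of fun r s => inner ℝ (G r) (a s)).det| : ℝ) : ℂ) := by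
  refine Complex.continuous_ofReal.comp (continuous_abs.comp (Continuous.matrix_det ?_))
  refine continuous_matrix fun r s => ?_
  simp only [Matrix.of_apply]
  fun_prop

theorem FrameIntegralEq.polarized {m n : ℕ} {c : ℝ} (H : FrameIntegralEq m n c)
    {a : Fin m → En n} (ha : Orthonormal ℝ a) {ψ χ : En n [⋀^Fin m]→L[ℝ] ℂ} (hψ : IsIsotropic ψ)
    (hχ : IsIsotropic χ) (hadd : IsIsotropic (ψ + χ)) :
    ∫ G, ((|(Matrix.of fun r s => inner ℝ (G r) (a s)).det| : ℝ) : ℂ) * (ψ G * χ G)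
      ∂framesMeasure m n = c * (ψ a * χ a) := by
  have hw := continuous_abs_det_inner a
  have h1 := H a ha _ hadd
  have hi : ∀ θ : En n [⋀^Fin m]→L[ℝ] ℂ, Integrable (fun G : Fin m → En n =>
      ((|(Matrix.of fun r s => inner ℝ (G r) (a s)).det| : ℝ) : ℂ) * θ G ^ 2)
      (framesMeasure m n) := fun θ => integrable_framesMeasure (hw.mul (θ.cont.pow 2))
  have hm : Integrable (fun G : Fin m → En n =>
      ((|(Matrix.of fun r s => inner ℝ (G r) (a s)).det| : ℝ) : ℂ) * (ψ G * χ G))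
      (framesMeasure m n) := integrable_framesMeasure (hw.mul (ψ.cont.mul χ.cont))
  have h2 : ∀ G : Fin m → En n,
      ((|(Matrix.of fun r s => inner ℝ (G r) (a s)).det| : ℝ) : ℂ) * (ψ + χ) G ^ 2 =
      (((|(Matrix.of fun r s => inner ℝ (G r) (a s)).det| : ℝ) : ℂ) * ψ G ^ 2 +
        ((|(Matrix.of fun r s => inner ℝ (G r) (a s)).det| : ℝ) : ℂ) * χ G ^ 2) +
      2 * (((|(Matrix.of fun r s => inner ℝ (G r) (a s)).det| : ℝ) : ℂ) * (ψ G * χ G)) := by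
    intro G
    rw [ContinuousAlternatingMap.add_apply]
    ring
  simp only [h2] at h1
  rw [integral_add (by exact (hi ψ).add (hi χ)) (hm.const_mul 2), integral_add (hi ψ) (hi χ),
    integral_const_mul, H a ha _ hψ, H a ha _ hχ, ContinuousAlternatingMap.add_apply] at h1
  linear_combination h1 / 2

theorem FrameIntegralEq.exists_linear {m n : ℕ} {c : ℝ} (H : FrameIntegralEq m n c)
    {a : Fin (m + 1) → En n} (ha : Orthonormal ℝ a) {ψ : En n [⋀^Fin (m + 1)]→L[ℝ] ℂ}
    (hψ : IsIsotropic ψ) (ξ : En (m + 1)) :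
    ∃ l : En n →ₗ[ℝ] ℂ,
      (∀ v w, ∫ G, ((|(Matrix.of (Fin.cons ξ fun r s => inner ℝ (G r) (a s)) :
        Matrix (Fin (m + 1)) (Fin (m + 1)) ℝ).det| : ℝ) : ℂ) *
          (ψ (Fin.cons v G) * ψ (Fin.cons w G)) ∂framesMeasure m n = c * ‖ξ‖ * (l v * l w)) ∧
      l (∑ s, ξ s • a s) ^ 2 = ‖ξ‖ ^ 2 * ψ a ^ 2 ∧ ∑ s, l (a s) ^ 2 = ψ a ^ 2 := by
  obtain ⟨β, hβ⟩ := exists_orthonormalBasis_eq_norm_smul ξ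
  set b : Fin (m + 1) → En n := fun t => frameIsometry ha (β t) with hb
  have hbo : Orthonormal ℝ b := β.orthonormal.comp_linearIsometry (frameIsometry ha)
  let l : En n →ₗ[ℝ] ℂ :=
    { toFun := fun v => ψ (Fin.cons v fun t => b t.succ)
      map_add' := fun v w => ψ.toAlternatingMap.map_vecCons_add _ v w
      map_smul' := fun r v => ψ.toAlternatingMap.map_vecCons_smul _ r v }
  have hl : ∀ v, l v = ψ (Fin.cons v fun t => b t.succ) := fun _ => rfl
  have hl0 : l (b 0) = ψ b := by
    rw [hl]; congr 1; funext t; refine Fin.cases rfl (fun _ => rfl) t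
  have hls : ∀ t : Fin m, l (b t.succ) = 0 := fun t =>
    ψ.map_eq_zero_of_eq _ (i := 0) (j := t.succ) (by simp) (Fin.succ_ne_zero t).symm
  have hsq : ψ b ^ 2 = ψ a ^ 2 := by
    have := sq_map_orthonormalBasis
      (ψ.compContinuousLinearMap (frameIsometry ha).toContinuousLinearMap) β
      (EuclideanSpace.basisFun _ ℝ)
    simp only [ContinuousAlternatingMap.compContinuousLinearMap_apply] at this
    convert this using 3
    · rfl
    · funext s
      simp [frameIsometry_apply]
  refine ⟨l, fun v w => ?_, ?_, ?_⟩
  · simp only [abs_det_cons_eq ha hβ]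
    have := H.polarized (hbo.comp _ (Fin.succ_injective m)) (hψ.curryLeft v) (hψ.curryLeft w)
      (by rw [← map_add]; exact hψ.curryLeft _)
    rw [mul_right_comm, hl, hl]
    refine Eq.trans ?_ (congrArg (· * (‖ξ‖ : ℂ)) this)
    rw [← integral_mul_const]
    congr 1
    funext G
    push_cast
    simp only [ContinuousAlternatingMap.curryLeft_apply_apply, Matrix.vecCons, hb,
      Function.comp_def]
    ring
  · have : ∑ s, ξ s • a s = ‖ξ‖ • b 0 := by
      rw [← frameIsometry_apply ha, ← map_smul, ← hβ]
    rw [this, map_smul, hl0, Complex.real_smul, mul_pow, hsq]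
  · have has : ∀ s, l (a s) = β 0 s * ψ b := by
      intro s
      have h1 : a s = ∑ t, β t s • b t := by
        have h2 := β.sum_repr (EuclideanSpace.single s 1)
        have h3 := congrArg (frameIsometry ha) h2
        simpa [frameIsometry_apply ha (EuclideanSpace.single s 1), OrthonormalBasis.repr_apply_apply,
          EuclideanSpace.inner_single_right] using h3.symm
      rw [h1, map_sum, Fin.sum_univ_succ]
      simp [hls, hl0]
    simp only [has, mul_pow]
    rw [← Finset.sum_mul, hsq]
    have hn := EuclideanSpace.norm_sq_eq (β 0)
    rw [β.norm_eq_one] at hn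
    simp only [Real.norm_eq_abs, sq_abs, one_pow] at hn
    rw [show ∑ s, (β 0 s : ℂ) ^ 2 = 1 by exact_mod_cast hn.symm, one_mul]

theorem integral_ballMeasure_pos {n : ℕ} {f : En n → ℝ} (hf : Continuous f) (h0 : ∀ x, 0 ≤ f x)
    {x : En n} (hx : ‖x‖ < 1) (hfx : f x ≠ 0) : 0 < ∫ x, f x ∂ballMeasure n := by
  rw [integral_pos_iff_support_of_nonneg h0 (integrable_ballMeasure hf), ballMeasure,
    Measure.restrict_apply' Metric.isClosed_closedBall.measurableSet]
  refine lt_of_lt_of_le ((hf.isOpen_support.inter Metric.isOpen_ball).measure_pos volume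
    ⟨x, hfx, mem_ball_zero_iff.2 hx⟩) (measure_mono ?_)
  exact Set.inter_subset_inter_right _ Metric.ball_subset_closedBall

/-- The first coordinates of a vector. -/
def headCoords {p q : ℕ} (z : En (p + q)) : En p := WithLp.toLp 2 fun s => z (Fin.castAdd q s)

theorem headCoords_apply {p q : ℕ} (z : En (p + q)) (s : Fin p) :
    headCoords z s = z (Fin.castAdd q s) := rfl

theorem continuous_headCoords {p q : ℕ} : Continuous (headCoords (p := p) (q := q)) := by
  unfold headCoords
  fun_prop

/-- The isometry changing the sign of one coordinate. -/
def signFlip {n : ℕ} (j : Fin n) : En n ≃ₗᵢ[ℝ] En n :=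
  LinearIsometryEquiv.piLpCongrRight 2 fun i =>
    if i = j then LinearIsometryEquiv.neg ℝ else LinearIsometryEquiv.refl ℝ ℝ

theorem signFlip_apply {n : ℕ} (j i : Fin n) (z : En n) :
    signFlip j z i = if i = j then -z i else z i := by
  simp only [signFlip, LinearIsometryEquiv.piLpCongrRight_apply]
  split_ifs <;> simp

/-- The isometry exchanging two coordinates. -/
def coordSwap {n : ℕ} (j p : Fin n) : En n ≃ₗᵢ[ℝ] En n :=
  LinearIsometryEquiv.piLpCongrLeft 2 ℝ ℝ (Equiv.swap j p)

theorem coordSwap_apply {n : ℕ} (j p i : Fin n) (z : En n) :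
    coordSwap j p z i = z (Equiv.swap j p i) := by
  simp [coordSwap, LinearIsometryEquiv.piLpCongrLeft_apply, Equiv.piCongrLeft']

theorem integral_headCoords_pos (m q : ℕ) :
    0 < ∫ z : En (m + 1 + (q + 1)), (‖headCoords z‖ ^ 3 -
      ‖headCoords z‖ * z (Fin.natAdd (m + 1) 0) ^ 2) ∂ballMeasure (m + 1 + (q + 1)) := by
  set o : Fin (m + 1 + (q + 1)) := Fin.castAdd (q + 1) 0 with ho
  set p : Fin (m + 1 + (q + 1)) := Fin.natAdd (m + 1) 0 with hp
  set N : En (m + 1 + (q + 1)) → ℝ := fun z => ‖headCoords z‖ with hN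
  have hop : o ≠ p := by simp [ho, hp, Fin.ext_iff]
  have hNc : Continuous N := continuous_headCoords.norm
  have hNsq : ∀ z, N z ^ 2 = z o ^ 2 + ∑ s : Fin m, z (Fin.castAdd (q + 1) s.succ) ^ 2 := by
    intro z
    rw [hN, EuclideanSpace.norm_sq_eq, Fin.sum_univ_succ]
    simp [headCoords_apply, ho]
  have hN0 : ∀ z, 0 ≤ N z := fun z => norm_nonneg _
  set τ := coordSwap o p with hτ
  have hτo : ∀ z, τ z o = z p := fun z => by simp [hτ, coordSwap_apply]
  have hτp : ∀ z, τ z p = z o := fun z => by simp [hτ, coordSwap_apply]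
  have hNτ : ∀ z, N (τ z) ^ 2 = z p ^ 2 + ∑ s : Fin m, z (Fin.castAdd (q + 1) s.succ) ^ 2 := by
    intro z
    rw [hNsq, hτo]
    congr 2
    funext s
    rw [hτ, coordSwap_apply, Equiv.swap_apply_of_ne_of_ne]
    · simp [ho, Fin.ext_iff]
    · simp [hp, Fin.ext_iff]; omega
  have hint : ∀ f : En (m + 1 + (q + 1)) → ℝ, Continuous f → Integrable f (ballMeasure _) :=
    fun f hf => integrable_ballMeasure hf
  have c1 : Continuous fun z : En (m + 1 + (q + 1)) => N z * (z o ^ 2 - z p ^ 2) := by fun_prop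
  have c2 : Continuous fun z : En (m + 1 + (q + 1)) => N (τ z) * (z p ^ 2 - z o ^ 2) := by
    have := τ.continuous
    fun_prop
  have hpos : 0 < ∫ z, (N z * (z o ^ 2 - z p ^ 2) + N (τ z) * (z p ^ 2 - z o ^ 2))
      ∂ballMeasure (m + 1 + (q + 1)) := by
    have heq : ∀ z, N z * (z o ^ 2 - z p ^ 2) + N (τ z) * (z p ^ 2 - z o ^ 2) =
        (N z - N (τ z)) ^ 2 * (N z + N (τ z)) := fun z => by
      linear_combination (N (τ z) - N z) * (hNsq z - hNτ z)
    refine integral_ballMeasure_pos (c1.add c2) (fun z => ?_)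
      (x := EuclideanSpace.single o (1 / 2)) ?_ ?_
    · rw [heq]
      exact mul_nonneg (sq_nonneg _) (add_nonneg (hN0 _) (hN0 _))
    · rw [PiLp.norm_single]; norm_num
    · have h1 := hNτ (EuclideanSpace.single o (1 / 2))
      have h2 := hNsq (EuclideanSpace.single o (1 / 2))
      have hz : ∀ s : Fin m, (EuclideanSpace.single o (1 / 2 : ℝ) : En (m + 1 + (q + 1)))
          (Fin.castAdd (q + 1) s.succ) = 0 := fun s => by
        simp [ho, Fin.ext_iff]
      have hzp : (EuclideanSpace.single o (1 / 2 : ℝ) : En (m + 1 + (q + 1))) p = 0 := by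
        simp [hop.symm]
      have hzo : (EuclideanSpace.single o (1 / 2 : ℝ) : En (m + 1 + (q + 1))) o = 1 / 2 := by
        simp
      simp only [hz, hzp, hzo] at h1 h2 ⊢
      simp only [ne_eq, OfNat.ofNat_ne_zero, not_false_eq_true, zero_pow,
        Finset.sum_const_zero, add_zero] at h1 h2
      rw [pow_eq_zero_iff two_ne_zero] at h1
      have : N (EuclideanSpace.single o (1 / 2)) ≠ 0 := fun h => by
        rw [h] at h2; norm_num at h2
      rw [h1, zero_mul, add_zero]
      exact mul_ne_zero this (by norm_num)
  have hsymm : ∫ z, N (τ z) * (z p ^ 2 - z o ^ 2) ∂ballMeasure (m + 1 + (q + 1)) =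
      ∫ z, N z * (z o ^ 2 - z p ^ 2) ∂ballMeasure (m + 1 + (q + 1)) := by
    rw [← integral_ballMeasure_comp τ fun z => N z * (z o ^ 2 - z p ^ 2)]
    simp only [hτo, hτp]
  rw [integral_add (hint _ c1) (hint _ c2), hsymm] at hpos
  refine lt_of_lt_of_le (by linarith) (integral_mono (hint _ c1) (hint _ <|
    (hNc.pow 3).sub (hNc.mul (by fun_prop))) fun z => ?_)
  have hs : 0 ≤ ∑ s : Fin m, z (Fin.castAdd (q + 1) s.succ) ^ 2 :=
    Finset.sum_nonneg fun _ _ => sq_nonneg _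
  have := mul_nonneg (hN0 z) hs
  change N z * (z o ^ 2 - z p ^ 2) ≤ N z ^ 3 - N z * z p ^ 2
  have h3 : N z ^ 3 = N z * (z o ^ 2 + ∑ s : Fin m, z (Fin.castAdd (q + 1) s.succ) ^ 2) := by
    rw [← hNsq]; ring
  rw [h3]
  linarith

/-- The contracted form of degree `2 * m` obtained by integrating out the last `m` vectors. -/
def innerForm {m n : ℕ} (a : Fin (m + 1) → En n) (ψ : En n [⋀^Fin (m + 1)]→L[ℝ] ℂ)
    (ξ : En (m + 1)) (v w : En n) : ℂ :=
  ∫ G, ((|(Matrix.of (Fin.cons ξ fun r s => inner ℝ (G r) (a s)) :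
    Matrix (Fin (m + 1)) (Fin (m + 1)) ℝ).det| : ℝ) : ℂ) *
      (ψ (Fin.cons v G) * ψ (Fin.cons w G)) ∂framesMeasure m n

theorem continuous_innerForm_integrand {m n : ℕ} (a : Fin (m + 1) → En n)
    (ψ : En n [⋀^Fin (m + 1)]→L[ℝ] ℂ) (v w : En n) :
    Continuous fun p : En (m + 1) × (Fin m → En n) =>
      ((|(Matrix.of (Fin.cons p.1 fun r s => inner ℝ (p.2 r) (a s)) :
        Matrix (Fin (m + 1)) (Fin (m + 1)) ℝ).det| : ℝ) : ℂ) *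
          (ψ (Fin.cons v p.2) * ψ (Fin.cons w p.2)) := by
  refine (Complex.continuous_ofReal.comp (continuous_abs.comp (Continuous.matrix_det ?_))).mul
    ((ψ.cont.comp ?_).mul (ψ.cont.comp ?_))
  · refine continuous_matrix fun r s => ?_
    refine Fin.cases ?_ (fun r => ?_) r
    · simp only [Matrix.of_apply, Fin.cons_zero]
      fun_prop
    · simp only [Matrix.of_apply, Fin.cons_succ]
      fun_prop
  · refine continuous_pi fun r => Fin.cases ?_ (fun r => ?_) r
    · simp only [Fin.cons_zero]; fun_prop
    · simp only [Fin.cons_succ]; fun_prop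
  · refine continuous_pi fun r => Fin.cases ?_ (fun r => ?_) r
    · simp only [Fin.cons_zero]; fun_prop
    · simp only [Fin.cons_succ]; fun_prop

theorem continuous_innerForm {m n : ℕ} (a : Fin (m + 1) → En n)
    (ψ : En n [⋀^Fin (m + 1)]→L[ℝ] ℂ) (v w : En n) :
    Continuous fun ξ => innerForm a ψ ξ v w :=
  continuous_integral_framesMeasure (continuous_innerForm_integrand a ψ v w)

theorem innerForm_sum {m n : ℕ} (a : Fin (m + 1) → En n) (ψ : En n [⋀^Fin (m + 1)]→L[ℝ] ℂ)
    (ξ : En (m + 1)) (z : En n) (B : OrthonormalBasis (Fin n) ℝ (En n)) :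
    innerForm a ψ ξ (B.repr.symm z) (B.repr.symm z) =
      ∑ j, ∑ l, (z j * z l : ℂ) * innerForm a ψ ξ (B j) (B l) := by
  have hc : ∀ v w, Continuous fun G : Fin m → En n =>
      ((|(Matrix.of (Fin.cons ξ fun r s => inner ℝ (G r) (a s)) :
        Matrix (Fin (m + 1)) (Fin (m + 1)) ℝ).det| : ℝ) : ℂ) *
          (ψ (Fin.cons v G) * ψ (Fin.cons w G)) := fun v w =>
    (continuous_innerForm_integrand a ψ v w).comp (continuous_const.prodMk continuous_id)
  have hlin : ∀ G : Fin m → En n,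
      ψ (Fin.cons (B.repr.symm z) G) = ∑ j, (z j : ℂ) * ψ (Fin.cons (B j) G) := by
    intro G
    have h := congrArg (fun x => ψ.curryLeft x G) (B.sum_repr_symm z)
    simp only [map_sum, map_smul] at h
    simpa [ContinuousAlternatingMap.curryLeft_apply_apply, Matrix.vecCons] using h.symm
  have hexp : ∀ G : Fin m → En n,
      ((|(Matrix.of (Fin.cons ξ fun r s => inner ℝ (G r) (a s)) :
        Matrix (Fin (m + 1)) (Fin (m + 1)) ℝ).det| : ℝ) : ℂ) *
          (ψ (Fin.cons (B.repr.symm z) G) * ψ (Fin.cons (B.repr.symm z) G)) =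
      ∑ j, ∑ l, (z j * z l : ℂ) *
        (((|(Matrix.of (Fin.cons ξ fun r s => inner ℝ (G r) (a s)) :
          Matrix (Fin (m + 1)) (Fin (m + 1)) ℝ).det| : ℝ) : ℂ) *
            (ψ (Fin.cons (B j) G) * ψ (Fin.cons (B l) G))) := by
    intro G
    rw [hlin, Finset.sum_mul_sum, Finset.mul_sum]
    refine Finset.sum_congr rfl fun j _ => ?_
    rw [Finset.mul_sum]
    exact Finset.sum_congr rfl fun l _ => by ring
  simp only [innerForm, hexp]
  rw [integral_finsetSum _ fun j _ => integrable_finsetSum _ fun l _ =>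
    (integrable_framesMeasure (hc _ _)).const_mul _]
  refine Finset.sum_congr rfl fun j _ => ?_
  rw [integral_finsetSum _ fun l _ => (integrable_framesMeasure (hc _ _)).const_mul _]
  exact Finset.sum_congr rfl fun l _ => integral_const_mul _ _

theorem IsIsotropic.sum_innerForm {m n : ℕ} {ψ : En n [⋀^Fin (m + 1)]→L[ℝ] ℂ}
    (h : IsIsotropic ψ) (a : Fin (m + 1) → En n) (ξ : En (m + 1))
    (B : OrthonormalBasis (Fin n) ℝ (En n)) : ∑ j, innerForm a ψ ξ (B j) (B j) = 0 := by
  have hc : ∀ v w, Continuous fun G : Fin m → En n =>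
      ((|(Matrix.of (Fin.cons ξ fun r s => inner ℝ (G r) (a s)) :
        Matrix (Fin (m + 1)) (Fin (m + 1)) ℝ).det| : ℝ) : ℂ) *
          (ψ (Fin.cons v G) * ψ (Fin.cons w G)) := fun v w =>
    (continuous_innerForm_integrand a ψ v w).comp (continuous_const.prodMk continuous_id)
  simp only [innerForm]
  rw [← integral_finsetSum _ fun j _ => integrable_framesMeasure (hc _ _)]
  simp only [← Finset.mul_sum, h.sum_cons, mul_zero, integral_zero]

theorem integral_headCoords_mul_eq_zero {p q : ℕ} {f : En p → ℂ} (j : Fin (p + q)) (l : Fin q)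
    (hjl : j ≠ Fin.natAdd p l) :
    ∫ z : En (p + q), (z j * z (Fin.natAdd p l) : ℂ) * f (headCoords z) ∂ballMeasure (p + q) = 0 := by
  have h := integral_ballMeasure_comp (signFlip (Fin.natAdd p l)) fun z : En (p + q) =>
    (z j * z (Fin.natAdd p l) : ℂ) * f (headCoords z)
  have hh : ∀ z, headCoords (signFlip (Fin.natAdd p l) z) = headCoords z := by
    intro z
    ext s
    simp only [headCoords_apply, signFlip_apply]
    rw [if_neg]
    simp [Fin.ext_iff]; omega
  simp only [hh, signFlip_apply, if_true, if_neg hjl] at h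
  simp only [Complex.ofReal_neg, mul_neg, neg_mul, integral_neg] at h
  exact self_eq_neg.1 h.symm

theorem integral_sq_mul_headCoords {p q : ℕ} {f : En p → ℂ} (l l' : Fin q) :
    ∫ z : En (p + q), (z (Fin.natAdd p l) * z (Fin.natAdd p l) : ℂ) * f (headCoords z)
        ∂ballMeasure (p + q) =
      ∫ z : En (p + q), (z (Fin.natAdd p l') : ℂ) ^ 2 * f (headCoords z) ∂ballMeasure (p + q) := by
  have h := integral_ballMeasure_comp (coordSwap (Fin.natAdd p l) (Fin.natAdd p l'))
    fun z : En (p + q) => (z (Fin.natAdd p l) * z (Fin.natAdd p l) : ℂ) * f (headCoords z)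
  have hh : ∀ z, headCoords (coordSwap (Fin.natAdd p l) (Fin.natAdd p l') z) = headCoords z := by
    intro z
    ext s
    rw [headCoords_apply, headCoords_apply, coordSwap_apply, Equiv.swap_apply_of_ne_of_ne] <;>
      simp [Fin.ext_iff] <;> omega
  simp only [hh, coordSwap_apply, Equiv.swap_apply_left] at h
  simp only [← h, sq]

theorem FrameIntegralEq.succ {m q : ℕ} {c : ℝ} (H : FrameIntegralEq m (m + 1 + (q + 1)) c) :
    FrameIntegralEq (m + 1) (m + 1 + (q + 1)) (c * ∫ z : En (m + 1 + (q + 1)),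
      (‖headCoords z‖ ^ 3 - ‖headCoords z‖ * z (Fin.natAdd (m + 1) 0) ^ 2)
        ∂ballMeasure (m + 1 + (q + 1))) := by
  intro a ha ψ hψ
  obtain ⟨B, hB⟩ : ∃ B : OrthonormalBasis (Fin (m + 1 + (q + 1))) ℝ (En (m + 1 + (q + 1))),
      ∀ s, B (Fin.castAdd (q + 1) s) = a s := by
    have ho : Orthonormal ℝ ((Set.range (Fin.castAdd (q + 1))).domRestrict
        (Fin.append a fun _ => 0)) := by
      have := ha.comp (Equiv.ofInjective _ (Fin.castAdd_injective (m + 1) (q + 1))).symm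
        (Equiv.injective _)
      convert this using 1
      funext ⟨x, s, hs⟩
      subst hs
      simp
    obtain ⟨B, hB⟩ := ho.exists_orthonormalBasis_extension_of_card_eq (by simp)
    exact ⟨B, fun s => by rw [hB _ ⟨s, rfl⟩, Fin.append_left]⟩
  have hdet : ∀ (z : En (m + 1 + (q + 1))) (G : Fin m → En (m + 1 + (q + 1))),
      (Matrix.of fun r s => inner ℝ ((Fin.cons (B.repr.symm z) G :
        Fin (m + 1) → En (m + 1 + (q + 1))) r) (a s)) =
      (Matrix.of (Fin.cons (headCoords z) fun r s => inner ℝ (G r) (a s)) :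
        Matrix (Fin (m + 1)) (Fin (m + 1)) ℝ) := by
    intro z G
    ext r s
    refine Fin.cases ?_ (fun r => ?_) r
    · simp only [Matrix.of_apply, Fin.cons_zero]
      rw [← hB, real_inner_comm, ← B.repr_apply_apply, LinearIsometryEquiv.apply_symm_apply]
      rfl
    · simp
  have hc2 : ∀ v w, Continuous fun z : En (m + 1 + (q + 1)) =>
      innerForm a ψ (headCoords z) v w := fun v w =>
    (continuous_innerForm a ψ v w).comp continuous_headCoords
  have hc3 : ∀ j l, Continuous fun z : En (m + 1 + (q + 1)) =>
      (z j * z l : ℂ) * innerForm a ψ (headCoords z) (B j) (B l) := by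
    intro j l
    have := hc2 (B j) (B l)
    fun_prop
  have hcont : Continuous fun G : Fin (m + 1) → En (m + 1 + (q + 1)) =>
      ((|(Matrix.of fun r s => inner ℝ (G r) (a s)).det| : ℝ) : ℂ) * ψ G ^ 2 :=
    (continuous_abs_det_inner a).mul (ψ.cont.pow 2)
  rw [integral_framesMeasure_succ hcont, ← integral_ballMeasure_comp B.repr.symm]
  have h1 : ∀ z, ∫ G, ((|(Matrix.of fun r s => inner ℝ ((Fin.cons (B.repr.symm z) G :
        Fin (m + 1) → En (m + 1 + (q + 1))) r) (a s)).det| : ℝ) : ℂ) *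
          ψ (Fin.cons (B.repr.symm z) G) ^ 2 ∂framesMeasure m (m + 1 + (q + 1)) =
      ∑ j, ∑ l, (z j * z l : ℂ) * innerForm a ψ (headCoords z) (B j) (B l) := by
    intro z
    rw [← innerForm_sum]
    simp only [hdet, innerForm, sq]
  simp only [h1]
  have hcross1 : ∀ (s : Fin (m + 1)) (l : Fin (q + 1)),
      ∫ z : En (m + 1 + (q + 1)), (z (Fin.castAdd (q + 1) s) * z (Fin.natAdd (m + 1) l) : ℂ) *
        innerForm a ψ (headCoords z) (B (Fin.castAdd (q + 1) s)) (B (Fin.natAdd (m + 1) l))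
          ∂ballMeasure _ = 0 := fun s l =>
    integral_headCoords_mul_eq_zero (f := fun ξ => innerForm a ψ ξ _ _) _ _
      (by simp [Fin.ext_iff]; omega)
  have hcross2 : ∀ (s : Fin (m + 1)) (l : Fin (q + 1)),
      ∫ z : En (m + 1 + (q + 1)), (z (Fin.natAdd (m + 1) l) * z (Fin.castAdd (q + 1) s) : ℂ) *
        innerForm a ψ (headCoords z) (B (Fin.natAdd (m + 1) l)) (B (Fin.castAdd (q + 1) s))
          ∂ballMeasure _ = 0 := fun s l => by
    rw [← integral_headCoords_mul_eq_zero (f := fun ξ => innerForm a ψ ξ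
      (B (Fin.natAdd (m + 1) l)) (B (Fin.castAdd (q + 1) s))) (Fin.castAdd (q + 1) s) l
      (by simp [Fin.ext_iff]; omega)]
    exact congrArg _ (funext fun z => by ring)
  have htail : ∀ l l' : Fin (q + 1),
      ∫ z : En (m + 1 + (q + 1)), (z (Fin.natAdd (m + 1) l) * z (Fin.natAdd (m + 1) l') : ℂ) *
        innerForm a ψ (headCoords z) (B (Fin.natAdd (m + 1) l)) (B (Fin.natAdd (m + 1) l'))
          ∂ballMeasure _ =
      if l' = l then ∫ z : En (m + 1 + (q + 1)), (z (Fin.natAdd (m + 1) 0) : ℂ) ^ 2 *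
        innerForm a ψ (headCoords z) (B (Fin.natAdd (m + 1) l)) (B (Fin.natAdd (m + 1) l))
          ∂ballMeasure _ else 0 := by
    intro l l'
    split_ifs with h
    · subst h
      exact integral_sq_mul_headCoords (f := fun ξ => innerForm a ψ ξ _ _) _ _
    · exact integral_headCoords_mul_eq_zero (f := fun ξ => innerForm a ψ ξ _ _) _ _
        (by simpa [Fin.ext_iff, eq_comm] using h)
  have hint := fun j l => integrable_ballMeasure (hc3 j l)
  have hint2 : ∀ l : Fin (q + 1), Integrable (fun z : En (m + 1 + (q + 1)) =>
      (z (Fin.natAdd (m + 1) 0) : ℂ) ^ 2 *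
        innerForm a ψ (headCoords z) (B (Fin.natAdd (m + 1) l)) (B (Fin.natAdd (m + 1) l)))
      (ballMeasure _) := fun l => integrable_ballMeasure (by
    have := hc2 (B (Fin.natAdd (m + 1) l)) (B (Fin.natAdd (m + 1) l))
    fun_prop)
  rw [integral_finsetSum _ fun j _ => integrable_finsetSum _ fun l _ => hint j l]
  simp only [integral_finsetSum _ fun l _ => hint _ l]
  simp only [Fin.sum_univ_add (a := m + 1) (b := q + 1), hcross1, hcross2, htail,
    Finset.sum_const_zero, Finset.sum_ite_eq', Finset.mem_univ, if_true, add_zero, zero_add]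
  rw [← integral_finsetSum _ fun l _ => hint2 l]
  simp only [← integral_finsetSum _ fun l _ => hint (Fin.castAdd (q + 1) _) (Fin.castAdd (q + 1) l)]
  rw [← integral_finsetSum _ fun j _ => integrable_finsetSum _ fun l _ =>
    hint (Fin.castAdd (q + 1) _) (Fin.castAdd (q + 1) l),
    ← integral_add (integrable_finsetSum _ fun j _ => integrable_finsetSum _ fun l _ =>
    hint (Fin.castAdd (q + 1) _) (Fin.castAdd (q + 1) l)) (integrable_finsetSum _ fun l _ => hint2 l)]
  push_cast
  rw [← integral_complex_ofReal, ← integral_const_mul, ← integral_mul_const]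
  congr 1
  funext z
  obtain ⟨l, hl, hl1, hl2⟩ := H.exists_linear ha hψ (headCoords z)
  have htr := hψ.sum_innerForm a (headCoords z) B
  rw [Fin.sum_univ_add] at htr
  simp only [hB] at htr ⊢
  have hin : ∀ v w, innerForm a ψ (headCoords z) v w = c * ‖headCoords z‖ * (l v * l w) := hl
  rw [← Finset.mul_sum, eq_neg_of_add_eq_zero_right htr]
  simp only [hin]
  have e1 : ∑ s, ∑ t, (z (Fin.castAdd (q + 1) s) * z (Fin.castAdd (q + 1) t) : ℂ) *
      (c * ‖headCoords z‖ * (l (a s) * l (a t))) =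
      c * ‖headCoords z‖ * l (∑ s, headCoords z s • a s) ^ 2 := by
    simp only [map_sum, map_smul, headCoords_apply, Complex.real_smul]
    rw [sq, Finset.sum_mul_sum, Finset.mul_sum]
    simp only [Finset.mul_sum]
    exact Finset.sum_congr rfl fun s _ => Finset.sum_congr rfl fun t _ => by ring
  have e2 : ∑ s, c * ‖headCoords z‖ * (l (a s) * l (a s)) = c * ‖headCoords z‖ * ψ a ^ 2 := by
    rw [← Finset.mul_sum, ← hl2]
    simp only [sq]
  rw [e1, e2, hl1]
  push_cast
  ring

theorem exists_frameIntegralEq {m n : ℕ} (h : m < n) : ∃ c, 0 < c ∧ FrameIntegralEq m n c := by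
  induction m with
  | zero =>
    refine ⟨(framesMeasure 0 n).real Set.univ, ?_, fun a _ ψ _ => ?_⟩
    · rw [framesMeasure, Measure.pi_of_empty]
      simp
    · have hG : ∀ G : Fin 0 → En n, G = a := fun G => Subsingleton.elim _ _
      simp [hG]
  | succ m ih =>
    obtain ⟨c, hc, H⟩ := ih (by omega)
    obtain ⟨q, rfl⟩ : ∃ q, n = m + 1 + (q + 1) := ⟨n - (m + 2), by omega⟩
    exact ⟨_, mul_pos hc (integral_headCoords_pos m q), H.succ⟩

/-- The complex coordinates of a real vector. -/
def complexCoords {d n : ℕ} (σ : Fin d ⊕ Fin d ≃ Fin n) (v : En n) (s : Fin d) : ℂ :=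
  v (σ (.inl s)) + v (σ (.inr s)) * Complex.I

theorem complexCoords_add {d n : ℕ} (σ : Fin d ⊕ Fin d ≃ Fin n) (v w : En n) :
    complexCoords σ (v + w) = complexCoords σ v + complexCoords σ w := by
  ext s
  simp [complexCoords]
  ring

theorem complexCoords_smul {d n : ℕ} (σ : Fin d ⊕ Fin d ≃ Fin n) (c : ℝ) (v : En n) :
    complexCoords σ (c • v) = (c : ℂ) • complexCoords σ v := by
  ext s
  simp [complexCoords]
  ring

theorem continuous_complexCoords {d n : ℕ} (σ : Fin d ⊕ Fin d ≃ Fin n) (s : Fin d) :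
    Continuous fun v => complexCoords σ v s := by
  unfold complexCoords
  fun_prop

theorem of_complexCoords_update {d n : ℕ} [DecidableEq (Fin d)] (σ : Fin d ⊕ Fin d ≃ Fin n)
    (v : Fin d → En n) (i : Fin d) (x : En n) :
    (Matrix.of fun r => complexCoords σ (Function.update v i x r)) =
      (Matrix.of fun r => complexCoords σ (v r)).updateRow i (complexCoords σ x) := by
  ext r s
  rcases eq_or_ne r i with rfl | h
  · simp
  · simp [Matrix.updateRow_ne h, Function.update_of_ne h]

/-- The complex determinant as an alternating form on a real vector space. -/
def detForm {d n : ℕ} (σ : Fin d ⊕ Fin d ≃ Fin n) : En n [⋀^Fin d]→L[ℝ] ℂ where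
  toFun G := (Matrix.of fun r => complexCoords σ (G r)).det
  map_update_add' {inst} v i x y := by
    obtain rfl : inst = instDecidableEqFin d := Subsingleton.elim _ _
    rw [of_complexCoords_update, of_complexCoords_update, of_complexCoords_update,
      complexCoords_add, Matrix.det_updateRow_add]
  map_update_smul' {inst} v i c x := by
    obtain rfl : inst = instDecidableEqFin d := Subsingleton.elim _ _
    rw [of_complexCoords_update, of_complexCoords_update, complexCoords_smul,
      Matrix.det_updateRow_smul, Complex.real_smul]
  map_eq_zero_of_eq' v i j h hij := Matrix.det_zero_of_row_eq hij (by
    funext s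
    simp [h])
  cont := Continuous.matrix_det (continuous_matrix fun r s =>
    (continuous_complexCoords σ s).comp (continuous_apply r))

theorem detForm_apply {d n : ℕ} (σ : Fin d ⊕ Fin d ≃ Fin n) (G : Fin d → En n) :
    detForm σ G = (Matrix.of fun r => complexCoords σ (G r)).det := rfl

theorem sum_complexCoords_mul {d n : ℕ} (σ : Fin d ⊕ Fin d ≃ Fin n)
    (B : OrthonormalBasis (Fin n) ℝ (En n)) (s t : Fin d) :
    ∑ j, complexCoords σ (B j) s * complexCoords σ (B j) t = 0 := by
  have hB : ∀ a b : Fin n, ∑ j, ((B j a : ℝ) : ℂ) * (B j b : ℝ) = if a = b then 1 else 0 := by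
    intro a b
    have h := B.sum_inner_mul_inner (EuclideanSpace.single a 1) (EuclideanSpace.single b 1)
    simp [EuclideanSpace.inner_single_left, EuclideanSpace.inner_single_right] at h
    have h' := congrArg Complex.ofReal h
    push_cast at h'
    rw [h']
    simp only [eq_comm (a := b)]
    split_ifs <;> simp
  have hexp : ∀ j, complexCoords σ (B j) s * complexCoords σ (B j) t =
      (B j (σ (.inl s)) : ℂ) * B j (σ (.inl t)) - (B j (σ (.inr s)) : ℂ) * B j (σ (.inr t)) +
      Complex.I * ((B j (σ (.inl s)) : ℂ) * B j (σ (.inr t)) +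
        (B j (σ (.inr s)) : ℂ) * B j (σ (.inl t))) := by
    intro j
    simp only [complexCoords]
    linear_combination (B j (σ (.inr s)) : ℂ) * B j (σ (.inr t)) * Complex.I_mul_I
  simp only [hexp, Finset.sum_add_distrib, Finset.sum_sub_distrib, ← Finset.mul_sum, hB]
  simp

theorem isIsotropic_detForm {d n : ℕ} (σ : Fin d ⊕ Fin d ≃ Fin n) : IsIsotropic (detForm σ) := by
  intro B i v w
  have h : ∀ (v : Fin d → En n) (x : En n), detForm σ (Function.update v i x) =
      ∑ s, (Matrix.of fun r => complexCoords σ (v r)).transpose.adjugate i s *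
        complexCoords σ x s := by
    intro v x
    rw [detForm_apply, of_complexCoords_update, ← Matrix.cramer_transpose_apply,
      Matrix.cramer_eq_adjugate_mulVec]
    rfl
  simp only [h, Finset.sum_mul_sum]
  rw [Finset.sum_comm]
  refine Finset.sum_eq_zero fun s _ => ?_
  rw [Finset.sum_comm]
  refine Finset.sum_eq_zero fun t _ => ?_
  simp only [mul_mul_mul_comm _ (complexCoords σ _ s), ← Finset.mul_sum, sum_complexCoords_mul,
    mul_zero]

theorem SOMat_mul {n : ℕ} (g h : SOGroup n) : SOMat (g * h) = SOMat g * SOMat h := rfl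

theorem SOMat_inv {n : ℕ} (g : SOGroup n) : SOMat g⁻¹ = (SOMat g).transpose := by
  change star (SOMat g) = _
  rw [Matrix.star_eq_conjTranspose, Matrix.conjTranspose_eq_transpose_of_trivial]

theorem continuous_SOMat {n : ℕ} : Continuous (SOMat (n := n)) :=
  continuous_subtype_val.comp continuous_subtype_val

instance (n : ℕ) : CompactSpace (SOGroup n) := by
  have hind : Topology.IsInducing (SOMat (n := n)) :=
    Topology.IsInducing.subtypeVal.comp Topology.IsInducing.subtypeVal
  refine ⟨hind.isCompact_iff.2 ?_⟩
  have hrange : SOMat '' (Set.univ : Set (SOGroup n)) =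
      {A : Matrix (Fin n) (Fin n) ℝ | A.transpose * A = 1 ∧ A.det = 1} := by
    ext A
    simp only [Set.image_univ, Set.mem_range, Set.mem_ofPred_eq]
    constructor
    · rintro ⟨g, rfl⟩
      refine ⟨?_, g.2⟩
      rw [← SOMat_inv, ← SOMat_mul, inv_mul_cancel]
      rfl
    · rintro ⟨h1, h2⟩
      exact ⟨⟨⟨A, (Matrix.mem_orthogonalGroup_iff' _ _).2 h1⟩, h2⟩, rfl⟩
  rw [hrange]
  refine IsCompact.of_isClosed_subset (s := Set.univ.pi fun _ => Set.univ.pi fun _ =>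
    Set.Icc (-1 : ℝ) 1) (isCompact_univ_pi fun _ => isCompact_univ_pi fun _ => isCompact_Icc)
    ?_ fun A hA i _ j _ => ?_
  · exact (isClosed_eq (by fun_prop) continuous_const).inter
      (isClosed_eq (continuous_id.matrix_det) continuous_const)
  · have h : ∑ l, A l j ^ 2 = 1 := by
      have h : (Matrix.of A).transpose * Matrix.of A = 1 := hA.1
      simpa [Matrix.mul_apply, sq] using congrFun (congrFun h j) j
    refine abs_le.1 (abs_le_one_iff_mul_self_le_one.2 ?_)
    rw [← h, ← sq]
    exact Finset.single_le_sum (f := fun l => A l j ^ 2) (fun _ _ => sq_nonneg _)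
      (Finset.mem_univ i)

instance (n : ℕ) : MeasurableSpace (SOGroup n) := borel _

instance (n : ℕ) : BorelSpace (SOGroup n) := ⟨rfl⟩

/-- The action of a rotation on a vector. -/
def rotVec {n : ℕ} (g : SOGroup n) (v : En n) : En n := Matrix.toEuclideanLin (SOMat g) v

theorem rotVec_apply {n : ℕ} (g : SOGroup n) (v : En n) (i : Fin n) :
    rotVec g v i = ∑ j, SOMat g i j * v j := rfl

theorem continuous_rotVec {n : ℕ} : Continuous fun p : SOGroup n × En n => rotVec p.1 p.2 := by
  refine (PiLp.continuous_toLp 2 _).comp (continuous_pi fun i => ?_)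
  have h : ∀ j, Continuous fun p : SOGroup n × En n => SOMat p.1 i j := fun j =>
    (continuous_SOMat.comp continuous_fst).matrix_elem i j
  change Continuous fun p : SOGroup n × En n => ∑ j, SOMat p.1 i j * p.2 j
  fun_prop

theorem rotVec_mul {n : ℕ} (g h : SOGroup n) (v : En n) :
    rotVec (g * h) v = rotVec g (rotVec h v) := by
  simp [rotVec, SOMat_mul, Matrix.toLpLin_apply]

theorem rotVec_one {n : ℕ} (v : En n) : rotVec 1 v = v := by
  have : SOMat (1 : SOGroup n) = 1 := rfl
  simp [rotVec, this]

theorem inner_rotVec {n : ℕ} (g : SOGroup n) (v w : En n) :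
    inner ℝ (rotVec g v) w = inner ℝ v (rotVec g⁻¹ w) := by
  simp only [PiLp.inner_apply, rotVec_apply, SOMat_inv, Matrix.transpose_apply, RCLike.inner_apply,
    conj_trivial, Finset.mul_sum, Finset.sum_mul]
  rw [Finset.sum_comm]
  exact Finset.sum_congr rfl fun i _ => Finset.sum_congr rfl fun j _ => by ring

theorem orthonormal_rotVec {n d : ℕ} (g : SOGroup n) {a : Fin d → En n} (ha : Orthonormal ℝ a) :
    Orthonormal ℝ fun s => rotVec g (a s) := by
  rw [orthonormal_iff_ite] at ha ⊢
  intro s t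
  rw [inner_rotVec, ← rotVec_mul, inv_mul_cancel, rotVec_one, ha]

theorem imageVol_rotBody {n d : ℕ} (g : SOGroup n) (G : Fin d → En n) (K : Body n) :
    imageVol G (rotBody g K) = imageVol (fun r => rotVec g⁻¹ (G r)) K := by
  have h : rowMap G '' (rotBody g K : Set (En n)) =
      rowMap (fun r => rotVec g⁻¹ (G r)) '' (K : Set (En n)) := by
    change rowMap G '' (rotVec g '' (K : Set (En n))) = _
    rw [Set.image_image]
    refine Set.image_congr fun v _ => ?_
    ext r
    rw [rowMap_apply, rowMap_apply, inner_rotVec, inv_inv]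
  rw [imageVol, h, imageVol]

/-- The valuation obtained by integrating the projected volumes of a rotated body against the
square of the complex determinant form. -/
def detVal {d n : ℕ} (σ : Fin d ⊕ Fin d ≃ Fin n) (g : SOGroup n) (K : Body n) : ℂ :=
  ∫ G, (imageVol (fun r => rotVec g (G r)) K : ℂ) * detForm σ G ^ 2 ∂framesMeasure d n

theorem continuous_detVal_integrand {d n : ℕ} (σ : Fin d ⊕ Fin d ≃ Fin n) :
    Continuous fun p : (SOGroup n × Body n) × (Fin d → En n) =>
      (imageVol (fun r => rotVec p.1.1 (p.2 r)) p.1.2 : ℂ) * detForm σ p.2 ^ 2 := by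
  refine (Complex.continuous_ofReal.comp (continuous_imageVol.comp
    (Continuous.prodMk (continuous_pi fun r => ?_) (by fun_prop)))).mul
    (((detForm σ).cont.comp continuous_snd).pow 2)
  exact continuous_rotVec.comp (f := fun p : (SOGroup n × Body n) × (Fin d → En n) =>
    (p.1.1, p.2 r)) (by fun_prop)

theorem continuous_detVal {d n : ℕ} (σ : Fin d ⊕ Fin d ≃ Fin n) :
    Continuous fun p : SOGroup n × Body n => detVal σ p.1 p.2 :=
  continuous_integral_framesMeasure (continuous_detVal_integrand σ)

theorem isValuation_detVal {d n : ℕ} (σ : Fin d ⊕ Fin d ≃ Fin n) (g : SOGroup n) :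
    IsValuation (detVal σ g) := by
  intro K L U I hU hI
  have hi : ∀ K : Body n, Integrable (fun G : Fin d → En n =>
      (imageVol (fun r => rotVec g (G r)) K : ℂ) * detForm σ G ^ 2) (framesMeasure d n) := by
    intro K
    have h := (continuous_detVal_integrand σ).comp
      (Continuous.prodMk_right (Y := Fin d → En n) (g, K))
    exact integrable_framesMeasure h
  simp only [detVal]
  rw [← integral_add (hi K) (hi L), ← integral_add (hi U) (hi I)]
  congr 1
  funext G
  rw [← add_mul, ← add_mul, ← Complex.ofReal_add, ← Complex.ofReal_add,
    isValuation_imageVol (fun r => rotVec g (G r)) K L U I hU hI]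

theorem detVal_transBody {d n : ℕ} (σ : Fin d ⊕ Fin d ≃ Fin n) (g : SOGroup n) (x : En n)
    (K : Body n) : detVal σ g (transBody x K) = detVal σ g K := by
  simp only [detVal, imageVol_transBody]

theorem detVal_scaleBody {d n : ℕ} (σ : Fin d ⊕ Fin d ≃ Fin n) (g : SOGroup n) {t : ℝ}
    (ht : 0 < t) (K : Body n) : detVal σ g (scaleBody t K) = (t : ℂ) ^ d * detVal σ g K := by
  simp only [detVal, imageVol_scaleBody _ ht, ← integral_const_mul]
  congr 1
  funext G
  push_cast
  ring

theorem detVal_rotBody {d n : ℕ} (σ : Fin d ⊕ Fin d ≃ Fin n) (g h : SOGroup n) (K : Body n) :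
    detVal σ g (rotBody h K) = detVal σ (h⁻¹ * g) K := by
  simp only [detVal, imageVol_rotBody, rotVec_mul]

theorem detVal_boxBody {d n : ℕ} {c : ℝ} (H : FrameIntegralEq d n c)
    (σ : Fin d ⊕ Fin d ≃ Fin n) (g : SOGroup n) {a : Fin d → En n} (ha : Orthonormal ℝ a) :
    detVal σ g (boxBody a) = c * detForm σ (fun s => rotVec g⁻¹ (a s)) ^ 2 := by
  rw [← H _ (orthonormal_rotVec g⁻¹ ha) _ (isIsotropic_detForm σ)]
  simp only [detVal, imageVol_boxBody, inner_rotVec]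

/-- The Hermitian average of `detVal` over the rotation group. -/
def detBival {d n : ℕ} (σ : Fin d ⊕ Fin d ≃ Fin n) (K L : Body n) : ℂ :=
  ∫ g, detVal σ g K * starRingEnd ℂ (detVal σ g L) ∂Measure.haar

theorem integrable_haar_of_continuous {n : ℕ} {f : SOGroup n → ℂ} (hf : Continuous f) :
    Integrable f Measure.haar :=
  hf.integrable_of_hasCompactSupport (HasCompactSupport.of_compactSpace f)

theorem continuous_detVal_left {d n : ℕ} (σ : Fin d ⊕ Fin d ≃ Fin n) (K : Body n) :
    Continuous fun g => detVal σ g K := by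
  have h := (continuous_detVal σ).comp (Continuous.prodMk_left (X := SOGroup n) K)
  exact h

theorem integrable_detBival {d n : ℕ} (σ : Fin d ⊕ Fin d ≃ Fin n) (K L : Body n) :
    Integrable (fun g => detVal σ g K * starRingEnd ℂ (detVal σ g L)) Measure.haar :=
  integrable_haar_of_continuous ((continuous_detVal_left σ K).mul
    (Complex.continuous_conj.comp (continuous_detVal_left σ L)))

theorem continuousBi_detBival {d n : ℕ} (σ : Fin d ⊕ Fin d ≃ Fin n) :
    ContinuousBi (detBival σ) := by
  have h : Continuous fun p : Body n × Body n => ∫ g in Set.univ,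
      detVal σ g p.1 * starRingEnd ℂ (detVal σ g p.2) ∂Measure.haar := by
    refine continuous_setIntegral_of_isCompact isCompact_univ ?_ fun p => ?_
    · refine Continuous.mul ?_ (Complex.continuous_conj.comp ?_)
      · exact (continuous_detVal σ).comp (f := fun q : (Body n × Body n) × SOGroup n =>
          (q.2, q.1.1)) (by fun_prop)
      · exact (continuous_detVal σ).comp (f := fun q : (Body n × Body n) × SOGroup n =>
          (q.2, q.1.2)) (by fun_prop)
    · exact (integrable_detBival σ p.1 p.2).integrableOn
  simp only [setIntegral_univ] at h
  exact h

theorem isBival_detBival {d n : ℕ} (σ : Fin d ⊕ Fin d ≃ Fin n) : IsBival (detBival σ) := by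
  refine ⟨fun M K L U I hU hI => ?_, fun M K L U I hU hI => ?_⟩
  · simp only [detBival]
    rw [← integral_add (integrable_detBival σ _ _) (integrable_detBival σ _ _),
      ← integral_add (integrable_detBival σ _ _) (integrable_detBival σ _ _)]
    simp only [← add_mul, isValuation_detVal σ _ K L U I hU hI]
  · simp only [detBival]
    rw [← integral_add (integrable_detBival σ _ _) (integrable_detBival σ _ _),
      ← integral_add (integrable_detBival σ _ _) (integrable_detBival σ _ _)]
    simp only [← mul_add, ← map_add, isValuation_detVal σ _ K L U I hU hI]

theorem isTransBiinv_detBival {d n : ℕ} (σ : Fin d ⊕ Fin d ≃ Fin n) :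
    IsTransBiinv (detBival σ) := by
  intro x y K L
  simp only [detBival, detVal_transBody]

theorem isBihomog_detBival {d n : ℕ} (σ : Fin d ⊕ Fin d ≃ Fin n) :
    IsBihomog d d (detBival σ) := by
  intro t s ht hs K L
  simp only [detBival, detVal_scaleBody σ _ ht, detVal_scaleBody σ _ hs, Complex.real_smul,
    ← integral_const_mul]
  congr 1
  funext g
  simp only [map_mul, map_pow, Complex.conj_ofReal]
  push_cast
  ring

theorem isSOBiinv_detBival {d n : ℕ} (σ : Fin d ⊕ Fin d ≃ Fin n) : IsSOBiinv (detBival σ) := by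
  intro h K L
  simp only [detBival, detVal_rotBody]
  exact integral_mul_left_eq_self
    (fun g => detVal σ g K * starRingEnd ℂ (detVal σ g L)) h⁻¹

theorem det_fromBlocks_swap (R : Type*) [CommRing R] (d : ℕ) :
    (Matrix.fromBlocks 0 1 1 0 : Matrix (Fin d ⊕ Fin d) (Fin d ⊕ Fin d) R).det = (-1) ^ d := by
  have h := Matrix.det_mul (Matrix.fromBlocks 1 1 0 1 : Matrix (Fin d ⊕ Fin d) (Fin d ⊕ Fin d) R)
    (Matrix.fromBlocks 0 1 1 0)
  rw [Matrix.fromBlocks_multiply, Matrix.det_fromBlocks_zero₂₁] at h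
  simp only [mul_zero, mul_one, zero_add, add_zero, one_mul, Matrix.det_one] at h
  rw [← h, Matrix.det_fromBlocks_one₁₁]
  simp [Matrix.det_neg]

/-- An off-diagonal block of a matrix preserving the swap form is singular if the matrix is proper
and the block has odd size. -/
theorem det_toBlocks₁₂_eq_zero {d : ℕ} (hd : Odd d)
    (T : Matrix (Fin d ⊕ Fin d) (Fin d ⊕ Fin d) ℂ) (hdet : T.det = 4 ^ d)
    (hT : T.transpose * Matrix.fromBlocks 0 1 1 0 * T =
      (4 : ℂ) • (Matrix.fromBlocks 0 1 1 0 : Matrix (Fin d ⊕ Fin d) (Fin d ⊕ Fin d) ℂ)) :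
    T.toBlocks₁₂.det = 0 := by
  rw [← Matrix.fromBlocks_toBlocks T] at hdet hT
  generalize T.toBlocks₁₁ = V at *
  generalize T.toBlocks₁₂ = U at *
  generalize T.toBlocks₂₁ = U' at *
  generalize T.toBlocks₂₂ = V' at *
  rw [Matrix.fromBlocks_transpose, Matrix.fromBlocks_multiply, Matrix.fromBlocks_multiply,
    Matrix.fromBlocks_smul, Matrix.fromBlocks_inj] at hT
  simp only [mul_zero, mul_one, zero_add, add_zero, smul_zero] at hT
  obtain ⟨-, -, h21, h22⟩ := hT
  have hL : Matrix.fromBlocks 1 0 V'.transpose U.transpose * Matrix.fromBlocks V U U' V' *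
      Matrix.fromBlocks 0 1 1 0 = Matrix.fromBlocks U V 0 ((4 : ℂ) • 1) := by
    rw [Matrix.fromBlocks_multiply, Matrix.fromBlocks_multiply, h21, h22]
    simp
  have h := congrArg Matrix.det hL
  rw [Matrix.det_mul, Matrix.det_mul, det_fromBlocks_swap, hdet, Matrix.det_fromBlocks_zero₁₂,
    Matrix.det_fromBlocks_zero₂₁, Matrix.det_one, Matrix.det_transpose, Matrix.det_smul,
    Matrix.det_one, hd.neg_one_pow, Fintype.card_fin] at h
  have h4 : (4 : ℂ) ^ d ≠ 0 := pow_ne_zero _ (by norm_num)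
  have : (2 * 4 ^ d : ℂ) * U.det = 0 := by linear_combination -h
  exact (mul_eq_zero.1 this).resolve_left (mul_ne_zero two_ne_zero h4)

theorem det_fromBlocks_special {d : ℕ} (hd : Odd d) (a b c e : Matrix (Fin d) (Fin d) ℂ)
    (horth : (Matrix.fromBlocks a b c e).transpose * Matrix.fromBlocks a b c e = 1)
    (hdet : (Matrix.fromBlocks a b c e).det = 1) :
    (a + Complex.I • c + Complex.I • (b + Complex.I • e)).det = 0 := by
  set M := Matrix.fromBlocks a b c e with hM
  set S : Matrix (Fin d ⊕ Fin d) (Fin d ⊕ Fin d) ℂ := Matrix.fromBlocks 0 1 1 0 with hS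
  set W : Matrix (Fin d ⊕ Fin d) (Fin d ⊕ Fin d) ℂ :=
    Matrix.fromBlocks 1 (Complex.I • 1) 1 (-(Complex.I • 1)) with hW
  set W' : Matrix (Fin d ⊕ Fin d) (Fin d ⊕ Fin d) ℂ :=
    Matrix.fromBlocks 1 1 (-(Complex.I • 1)) (Complex.I • 1) with hW'
  have hWW : W * W' = (2 : ℂ) • 1 := by
    rw [hW, hW', Matrix.fromBlocks_multiply, ← Matrix.fromBlocks_one, Matrix.fromBlocks_smul]
    simp [smul_smul, two_smul]
  have hWS : W.transpose * S * W = (2 : ℂ) • 1 := by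
    rw [hW, hS, Matrix.fromBlocks_transpose, Matrix.fromBlocks_multiply,
      Matrix.fromBlocks_multiply, ← Matrix.fromBlocks_one, Matrix.fromBlocks_smul]
    simp [smul_smul, two_smul]
  have hWW' : W'.transpose * W' = (2 : ℂ) • S := by
    rw [hW', hS, Matrix.fromBlocks_transpose, Matrix.fromBlocks_multiply, Matrix.fromBlocks_smul]
    simp [smul_smul, two_smul]
  have h := det_toBlocks₁₂_eq_zero hd (W * M * W') ?_ ?_
  · rw [hW, hM, hW', Matrix.fromBlocks_multiply, Matrix.fromBlocks_multiply,
      Matrix.toBlocks_fromBlocks₁₂] at h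
    rw [← h]
    congr 1
    simp only [one_mul, smul_mul_assoc, mul_one, mul_smul_comm]
  · rw [Matrix.det_mul, Matrix.det_mul, hdet, mul_one, ← Matrix.det_mul, hWW, Matrix.det_smul,
      Matrix.det_one, mul_one, Fintype.card_sum, Fintype.card_fin, ← two_mul, pow_mul]
    norm_num
  · calc (W * M * W').transpose * S * (W * M * W')
        = W'.transpose * (M.transpose * (W.transpose * S * W) * M) * W' := by
          simp only [Matrix.transpose_mul, Matrix.mul_assoc]
      _ = (4 : ℂ) • S := by
          rw [hWS, mul_smul_comm, mul_one, smul_mul_assoc, horth, mul_smul_comm, mul_one,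
            smul_mul_assoc, hWW', smul_smul]
          norm_num

theorem polynomial_eq_zero_of_forall_real {p : Polynomial ℂ} (h : ∀ t : ℝ, p.eval (t : ℂ) = 0) :
    p = 0 := by
  refine Polynomial.eq_zero_of_infinite_isRoot p
    ((Set.infinite_range_of_injective Complex.ofReal_injective).mono ?_)
  rintro _ ⟨t, rfl⟩
  exact h t

theorem coeff_eq_zero_of_forall_real {N : ℕ} {c : ℕ → ℂ}
    (h : ∀ t : ℝ, ∑ j ∈ Finset.range N, c j * (t : ℂ) ^ j = 0) {j : ℕ} (hj : j < N) : c j = 0 := by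
  have hp : ∑ j ∈ Finset.range N, Polynomial.C (c j) * Polynomial.X ^ j = 0 :=
    polynomial_eq_zero_of_forall_real fun t => by
      simpa [Polynomial.eval_finsetSum] using h t
  simpa [Polynomial.finsetSum_coeff, Polynomial.coeff_C_mul, Polynomial.coeff_X_pow, hj] using
    congrArg (fun p => Polynomial.coeff p j) hp

/-- If a polynomial family of functions has symmetric Gram kernel at real parameters, then its
sesquilinear Gram kernel takes equal values at conjugate parameters. -/
theorem integral_eval_conj_of_symm {X : Type*} [TopologicalSpace X] [MeasurableSpace X]
    (μ : Measure X) (hint : ∀ f : C(X, ℂ), Integrable f μ) (p : Polynomial C(X, ℂ))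
    (h : ∀ s t : ℝ,
      ∫ x, p.eval (algebraMap ℂ _ s) x * starRingEnd ℂ (p.eval (algebraMap ℂ _ t) x) ∂μ =
      ∫ x, p.eval (algebraMap ℂ _ t) x * starRingEnd ℂ (p.eval (algebraMap ℂ _ s) x) ∂μ) (z : ℂ) :
    ∫ x, p.eval (algebraMap ℂ _ z) x * starRingEnd ℂ (p.eval (algebraMap ℂ _ z) x) ∂μ =
      ∫ x, p.eval (algebraMap ℂ _ (starRingEnd ℂ z)) x *
        starRingEnd ℂ (p.eval (algebraMap ℂ _ (starRingEnd ℂ z)) x) ∂μ := by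
  set N := p.natDegree + 1
  set c : ℕ → ℕ → ℂ := fun j l => ∫ x, p.coeff j x * starRingEnd ℂ (p.coeff l x) ∂μ with hc
  have hexp : ∀ z w : ℂ,
      ∫ x, p.eval (algebraMap ℂ _ z) x * starRingEnd ℂ (p.eval (algebraMap ℂ _ w) x) ∂μ =
      ∑ j ∈ Finset.range N, (∑ l ∈ Finset.range N, c j l * starRingEnd ℂ w ^ l) * z ^ j := by
    intro z w
    have hev : ∀ (z : ℂ) (x : X), p.eval (algebraMap ℂ _ z) x =
        ∑ j ∈ Finset.range N, p.coeff j x * z ^ j := by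
      intro z x
      rw [Polynomial.eval_eq_sum_range]
      simp [ContinuousMap.sum_apply, N]
    have hi : ∀ j l, Integrable (fun x => p.coeff j x * z ^ j *
        (starRingEnd ℂ (p.coeff l x) * starRingEnd ℂ w ^ l)) μ := fun j l =>
      ((hint (p.coeff j * star (p.coeff l))).mul_const (z ^ j * starRingEnd ℂ w ^ l)).congr
        (Filter.Eventually.of_forall fun x => mul_mul_mul_comm _ _ _ _)
    simp only [hev, map_sum, map_mul, map_pow, Finset.sum_mul_sum]
    simp only [hc, Finset.sum_mul]
    rw [integral_finsetSum _ fun j _ => integrable_finsetSum _ fun l _ => hi j l]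
    refine Finset.sum_congr rfl fun j _ => ?_
    rw [integral_finsetSum _ fun l _ => hi j l]
    refine Finset.sum_congr rfl fun l _ => ?_
    rw [← integral_mul_const, ← integral_mul_const]
    congr 1
    funext x
    ring
  have hswap : ∀ z w : ℂ,
      ∑ j ∈ Finset.range N, (∑ l ∈ Finset.range N, c j l * w ^ l) * z ^ j =
      ∑ j ∈ Finset.range N, (∑ l ∈ Finset.range N, c l j * z ^ l) * w ^ j := by
    intro z w
    simp only [Finset.sum_mul]
    rw [Finset.sum_comm]
    exact Finset.sum_congr rfl fun j _ => Finset.sum_congr rfl fun l _ => by ring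
  have hsymm : ∀ j < N, ∀ l < N, c j l - c l j = 0 := by
    intro j hj l hl
    refine coeff_eq_zero_of_forall_real (c := fun l => c j l - c l j) (fun t => ?_) hl
    refine coeff_eq_zero_of_forall_real
      (c := fun j => ∑ l ∈ Finset.range N, (c j l - c l j) * (t : ℂ) ^ l) (fun s => ?_) hj
    have := h s t
    rw [hexp, hexp, Complex.conj_ofReal, Complex.conj_ofReal, hswap t s] at this
    simp only [sub_mul, Finset.sum_sub_distrib]
    rw [this, sub_self]
  rw [hexp, hexp, Complex.conj_conj, hswap _ z]
  refine Finset.sum_congr rfl fun j hj => ?_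
  congr 1
  refine Finset.sum_congr rfl fun l hl => ?_
  rw [sub_eq_zero.1 (hsymm j (Finset.mem_range.1 hj) l (Finset.mem_range.1 hl))]

/-- The complex coordinates of the rotated coordinate vectors with indices `τ`, as a matrix of
continuous functions of the rotation. -/
def rotBlock {d n : ℕ} (σ : Fin d ⊕ Fin d ≃ Fin n) (τ : Fin d → Fin n) :
    Matrix (Fin d) (Fin d) C(SOGroup n, ℂ) :=
  Matrix.of fun j s =>
    { toFun := fun g => complexCoords σ (rotVec g⁻¹ (EuclideanSpace.single (τ j) 1)) s
      continuous_toFun := by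
        have h := continuous_rotVec.comp ((continuous_inv (G := SOGroup n)).prodMk
          (continuous_const (y := EuclideanSpace.single (τ j) (1 : ℝ))))
        exact (continuous_complexCoords σ s).comp h }

/-- The squared determinant form along a pencil of planes, as a polynomial in the parameter. -/
def pencilPoly {d n : ℕ} (σ : Fin d ⊕ Fin d ≃ Fin n) : Polynomial C(SOGroup n, ℂ) :=
  ((rotBlock σ (σ ∘ .inl)).map Polynomial.C +
    (Polynomial.X : Polynomial C(SOGroup n, ℂ)) •
      (rotBlock σ (σ ∘ .inr)).map Polynomial.C).det ^ 2

theorem eval_pencilPoly {d n : ℕ} (σ : Fin d ⊕ Fin d ≃ Fin n) (z : ℂ) (g : SOGroup n) :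
    (pencilPoly σ).eval (algebraMap ℂ _ z) g = (Matrix.of fun j s =>
      complexCoords σ (rotVec g⁻¹ (EuclideanSpace.single (σ (.inl j)) 1)) s +
        z * complexCoords σ (rotVec g⁻¹ (EuclideanSpace.single (σ (.inr j)) 1)) s).det ^ 2 := by
  let φ : Polynomial C(SOGroup n, ℂ) →+* ℂ := ((Pi.evalRingHom (fun _ : SOGroup n => ℂ) g).comp
    ContinuousMap.coeFnRingHom).comp (Polynomial.evalRingHom (algebraMap ℂ C(SOGroup n, ℂ) z))
  change φ (pencilPoly σ) = _
  rw [pencilPoly, map_pow, RingHom.map_det]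
  congr 2
  ext j s
  simp [φ, rotBlock, mul_comm z]

/-- A pencil of orthonormal `d`-frames joining the real and imaginary coordinate planes. -/
def pencilFrame {d n : ℕ} (σ : Fin d ⊕ Fin d ≃ Fin n) (t : ℝ) (j : Fin d) : En n :=
  (√(1 + t ^ 2))⁻¹ •
    (EuclideanSpace.single (σ (.inl j)) 1 + t • EuclideanSpace.single (σ (.inr j)) 1)

theorem orthonormal_pencilFrame {d n : ℕ} (σ : Fin d ⊕ Fin d ≃ Fin n) (t : ℝ) :
    Orthonormal ℝ (pencilFrame σ t) := by
  have ht : 0 < 1 + t ^ 2 := by positivity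
  have hr : (√(1 + t ^ 2))⁻¹ * ((√(1 + t ^ 2))⁻¹ * (1 + t * t)) = 1 := by
    have := Real.mul_self_sqrt ht.le
    have h0 := (Real.sqrt_pos.2 ht).ne'
    field_simp
    linarith
  rw [orthonormal_iff_ite]
  intro i j
  simp only [pencilFrame, inner_smul_left, inner_smul_right, inner_add_left, inner_add_right,
    EuclideanSpace.inner_single_left]
  rcases eq_or_ne i j with rfl | h
  · simp
    linear_combination hr
  · simp [h]

theorem detVal_boxBody_pencilFrame {d n : ℕ} {c : ℝ} (H : FrameIntegralEq d n c)
    (σ : Fin d ⊕ Fin d ≃ Fin n) (g : SOGroup n) (t : ℝ) :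
    detVal σ g (boxBody (pencilFrame σ t)) = ((c * ((√(1 + t ^ 2))⁻¹ ^ d) ^ 2 : ℝ) : ℂ) *
      (pencilPoly σ).eval (algebraMap ℂ _ (t : ℂ)) g := by
  rw [detVal_boxBody H σ g (orthonormal_pencilFrame σ t), eval_pencilPoly]
  have hrot : ∀ j, rotVec g⁻¹ (pencilFrame σ t j) = (√(1 + t ^ 2))⁻¹ •
      (rotVec g⁻¹ (EuclideanSpace.single (σ (.inl j)) 1) +
        t • rotVec g⁻¹ (EuclideanSpace.single (σ (.inr j)) 1)) := by
    intro j
    simp only [pencilFrame, rotVec, map_smul, map_add]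
  have hdet : detForm σ (fun j => rotVec g⁻¹ (pencilFrame σ t j)) =
      (((√(1 + t ^ 2))⁻¹ ^ d : ℝ) : ℂ) * (Matrix.of fun j s =>
      complexCoords σ (rotVec g⁻¹ (EuclideanSpace.single (σ (.inl j)) 1)) s +
      t * complexCoords σ (rotVec g⁻¹ (EuclideanSpace.single (σ (.inr j)) 1)) s).det := by
    simp only [hrot]
    rw [ContinuousAlternatingMap.map_smul_univ (detForm σ) (fun _ => (√(1 + t ^ 2))⁻¹),
      Finset.prod_const, Finset.card_fin, Complex.real_smul, detForm_apply]
    simp only [complexCoords_add, complexCoords_smul]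
    rfl
  rw [hdet]
  push_cast
  ring

theorem eval_pencilPoly_I {d n : ℕ} (hd : Odd d) (σ : Fin d ⊕ Fin d ≃ Fin n) (g : SOGroup n) :
    (pencilPoly σ).eval (algebraMap ℂ _ Complex.I) g = 0 := by
  rw [eval_pencilPoly, ← Matrix.det_transpose, sq_eq_zero_iff]
  set A : Matrix (Fin n) (Fin n) ℂ := (SOMat g⁻¹).map Complex.ofRealHom with hA
  have hAA : A.transpose * A = 1 := by
    have h : SOMat (g⁻¹)⁻¹ * SOMat g⁻¹ = 1 := by
      rw [← SOMat_mul, inv_mul_cancel]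
      rfl
    rw [SOMat_inv (g⁻¹)] at h
    rw [hA, ← Matrix.transpose_map, ← Matrix.map_mul, h]
    simp
  have hdet : A.det = 1 := by
    have h : (SOMat g⁻¹).det = 1 := (g⁻¹).2
    rw [hA, ← RingHom.mapMatrix_apply, ← RingHom.map_det, h, map_one]
  set M := A.submatrix σ σ with hM
  have h := det_fromBlocks_special hd M.toBlocks₁₁ M.toBlocks₁₂ M.toBlocks₂₁ M.toBlocks₂₂
    (by rw [Matrix.fromBlocks_toBlocks, hM, Matrix.transpose_submatrix,
      Matrix.submatrix_mul_equiv, hAA, Matrix.submatrix_one_equiv])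
    (by rw [Matrix.fromBlocks_toBlocks, hM, Matrix.det_submatrix_equiv_self, hdet])
  rw [← h]
  congr 1
  ext s j
  simp [complexCoords, rotVec_apply, M, A, Matrix.toBlocks₁₁, Matrix.toBlocks₁₂,
    Matrix.toBlocks₂₁, Matrix.toBlocks₂₂]
  ring

theorem eval_pencilPoly_neg_I_one {d n : ℕ} (σ : Fin d ⊕ Fin d ≃ Fin n) :
    (pencilPoly σ).eval (algebraMap ℂ _ (-Complex.I)) 1 ≠ 0 := by
  rw [eval_pencilPoly]
  have h : (Matrix.of fun j s =>
      complexCoords σ (rotVec 1⁻¹ (EuclideanSpace.single (σ (.inl j)) 1)) s + -Complex.I *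
        complexCoords σ (rotVec 1⁻¹ (EuclideanSpace.single (σ (.inr j)) 1)) s) =
      (2 : ℂ) • (1 : Matrix (Fin d) (Fin d) ℂ) := by
    ext j s
    rcases eq_or_ne j s with rfl | hjs
    · simp [complexCoords, rotVec_one, one_add_one_eq_two]
    · simp [complexCoords, rotVec_one, hjs, hjs.symm]
  rw [h, Matrix.det_smul, Matrix.det_one]
  simp

/-- For odd `d` the average of `detVal` is not symmetric. -/
theorem exists_detBival_ne {d n : ℕ} (hd : Odd d) (hdn : d < n) (σ : Fin d ⊕ Fin d ≃ Fin n) :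
    ∃ K L : Body n, detBival σ K L ≠ detBival σ L K := by
  obtain ⟨c, hc, H⟩ := exists_frameIntegralEq hdn
  by_contra! hsymm
  set p := pencilPoly σ
  set q : ℝ → ℝ := fun t => c * ((√(1 + t ^ 2))⁻¹ ^ d) ^ 2
  have hq : ∀ t, ((q t : ℝ) : ℂ) ≠ 0 := fun t => Complex.ofReal_ne_zero.2 (by positivity)
  have hbox : ∀ s t : ℝ, detBival σ (boxBody (pencilFrame σ s)) (boxBody (pencilFrame σ t)) =
      q s * q t * ∫ g, p.eval (algebraMap ℂ _ (s : ℂ)) g *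
        starRingEnd ℂ (p.eval (algebraMap ℂ _ (t : ℂ)) g) ∂Measure.haar := by
    intro s t
    simp only [detBival, detVal_boxBody_pencilFrame H, map_mul, Complex.conj_ofReal]
    rw [← integral_const_mul]
    congr 1
    funext g
    ring
  have h := integral_eval_conj_of_symm (Measure.haar (G := SOGroup n))
    (fun f => integrable_haar_of_continuous f.continuous) p (fun s t => by
      have h := hsymm (boxBody (pencilFrame σ s)) (boxBody (pencilFrame σ t))
      rw [hbox, hbox, mul_comm (q t : ℂ)] at h
      exact mul_left_cancel₀ (mul_ne_zero (hq s) (hq t)) h) Complex.I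
  set f : C(SOGroup n, ℂ) := p.eval (algebraMap ℂ _ (-Complex.I))
  have hpos : 0 < ∫ g, ‖f g‖ ^ 2 ∂Measure.haar (G := SOGroup n) :=
    Continuous.integral_pos_of_hasCompactSupport_nonneg_nonzero (by fun_prop)
      (HasCompactSupport.of_compactSpace _) (fun g => by positivity) (x := 1)
      (pow_ne_zero 2 (norm_ne_zero_iff.2 (eval_pencilPoly_neg_I_one σ)))
  refine hpos.ne' (Complex.ofReal_injective ?_)
  rw [Complex.ofReal_zero, ← integral_complex_ofReal]
  simp only [p, eval_pencilPoly_I hd, zero_mul, integral_zero, Complex.conj_I] at h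
  rw [h]
  congr 1
  funext g
  rw [Complex.mul_conj, Complex.normSq_eq_norm_sq]

end

/-- For `i = 2k+1` and `n = 4k+2` there exists a continuous translation biinvariant
`SO(n)` invariant bivaluation of bidegree `(i,i)` which is not symmetric. -/
theorem exists_nonsymmetric_SO_bivaluation (k : ℕ) (hn : 3 ≤ 4 * k + 2) :
    ∃ (ζ : Body (4 * k + 2) → Body (4 * k + 2) → ℂ) (K L : Body (4 * k + 2)),
      ContinuousBi ζ ∧ IsBival ζ ∧ IsTransBiinv ζ ∧
      IsBihomog (2 * k + 1) (2 * k + 1) ζ ∧ IsSOBiinv ζ ∧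
      ζ K L ≠ ζ L K := by
  have hd : Odd (2 * k + 1) := odd_two_mul_add_one k
  let σ : Fin (2 * k + 1) ⊕ Fin (2 * k + 1) ≃ Fin (4 * k + 2) :=
    finSumFinEquiv.trans (finCongr (by omega))
  obtain ⟨K, L, h⟩ := exists_detBival_ne hd (by omega) σ
  exact ⟨detBival σ, K, L, continuousBi_detBival σ, isBival_detBival σ, isTransBiinv_detBival σ,
    isBihomog_detBival σ, isSOBiinv_detBival σ, h⟩
end
end
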